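/- arXiv:1905.10560 — 2 statements merged into one kernel-verified Lean document; each statement's English description precedes it below -/
import Mathlib

section
/- Let k ≥ 1 and let G = G_{2k−1}(m₁, 0, m₂, 0, …, m_{k−1}, 0, m_k) be the caterpillar graph whose central path has 2k−1 vertices, where each even-indexed path vertex has no legs (degree 2 on the path) and the (2i−1)-th path vertex has m_i ≥ 1 pendant edges for i = 1, …, k. Set a_i = m_i − 1. Then the matching complex M(G) is homotopy equivalent to a wedge of L_k(a₁, a₂, …, a_k) spheres, all of dimension k − 1. -/
open SimpleGraph

/-- Two edges (as elements of `Sym2 V`) are incident if they share a vertex. -/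
def EdgeIncident {V : Type*} (e f : Sym2 V) : Prop := ∃ v, v ∈ e ∧ v ∈ f

/-- The matching complex of a graph, as the set of its faces:
finite sets of pairwise non-incident edges of `G`. -/
def matchingComplex {V : Type*} (G : SimpleGraph V) : Set (Finset (Sym2 V)) :=
  {m | (∀ e ∈ m, e ∈ G.edgeSet) ∧
    (m : Set (Sym2 V)).Pairwise fun e f => ¬ EdgeIncident e f}

/-- The geometric realization of an abstract simplicial complex, given as a
downward-closed set of finite subsets of the vertex type `α`. -/
abbrev Realization {α : Type*} (K : Set (Finset α)) : Type _ :=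
  { f : α → ℝ // (∀ a, 0 ≤ f a) ∧
      ∃ s ∈ K, (∀ a, f a ≠ 0 → a ∈ s) ∧ ∑ a ∈ s, f a = 1 }

/-- The `n`-dimensional sphere. -/
abbrev SphereD (n : ℕ) : Type :=
  Metric.sphere (0 : EuclideanSpace ℝ (Fin (n + 1))) 1

/-- A basepoint of the `n`-sphere. -/
noncomputable def SphereD.pt (n : ℕ) : SphereD n :=
  ⟨EuclideanSpace.single 0 1, by simp [EuclideanSpace.norm_single]⟩

/-- The relation collapsing all basepoints (and the extra point) of a
family of pointed spaces to one point. -/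
def WedgeRel {ι : Type*} (X : ι → Type*) (pt : ∀ i, X i) :
    ((Σ i, X i) ⊕ Unit) → ((Σ i, X i) ⊕ Unit) → Prop := fun p q =>
  (p = Sum.inr () ∨ ∃ i, p = Sum.inl ⟨i, pt i⟩) ∧
  (q = Sum.inr () ∨ ∃ i, q = Sum.inl ⟨i, pt i⟩)

/-- The wedge sum of a family of pointed spaces (with an extra basepoint, so that
the wedge of the empty family is a one-point space). -/
abbrev PWedge {ι : Type*} (X : ι → Type*) [∀ i, TopologicalSpace (X i)]
    (pt : ∀ i, X i) : Type _ :=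
  Quot (WedgeRel X pt)

/-- A wedge of spheres with prescribed dimensions `d i`. -/
noncomputable abbrev WedgeOfSpheres {ι : Type*} (d : ι → ℕ) : Type _ :=
  PWedge (fun i => SphereD (d i)) (fun i => SphereD.pt (d i))

/-- The caterpillar graph on a central path with `n` vertices, with `m i` pendant
edges (legs) attached to the `i`-th path vertex. -/
def caterpillar (n : ℕ) (m : Fin n → ℕ) :
    SimpleGraph (Fin n ⊕ Σ i : Fin n, Fin (m i)) :=
  SimpleGraph.fromRel fun p q =>
    match p, q with
    | Sum.inl i, Sum.inl j => (i : ℕ) + 1 = (j : ℕ)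
    | Sum.inl i, Sum.inr j => i = j.1
    | _, _ => False

/-- The product `(i₂−i₁)(i₃−i₂)⋯(i_ℓ−i_{ℓ−1})` of consecutive differences of the
elements `i₁ < i₂ < ⋯ < i_ℓ` of a finite set of naturals. -/
def consecDiffProd (s : Finset ℕ) : ℕ :=
  (((s.sort (· ≤ ·)).zip (s.sort (· ≤ ·)).tail).map fun p => p.2 - p.1).prod

/-- `L_k(a₁, …, a_k) = Σ_{ℓ=1}^{k} Σ_{1 ≤ i₁ < ⋯ < i_ℓ ≤ k}
(i₂−i₁)⋯(i_ℓ−i_{ℓ−1}) a_{i₁} ⋯ a_{i_ℓ}` (here with values in `ℕ`). -/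
def LsumNat (k : ℕ) (a : ℕ → ℕ) : ℕ :=
  ∑ s ∈ (Finset.Icc 1 k).powerset.filter (fun s => s.Nonempty),
    consecDiffProd s * ∏ i ∈ s, a i

section Collapse

open Set Topology

/-- Two spaces which contain `E` as an open subspace, the second one with one-point complement:
the map that collapses the complement of `E` to that point. -/
noncomputable def collapseMap {X W E : Type*} (θ : E → X) (j : E → W) (b : W) (x : X) : W :=
  open Classical in if h : ∃ e, θ e = x then j h.choose else b

theorem collapseMap_apply {X W E : Type*} {θ : E → X} (hθ : Function.Injective θ) (j : E → W)
    (b : W) (e : E) : collapseMap θ j b (θ e) = j e := by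
  have h : ∃ e', θ e' = θ e := ⟨e, rfl⟩
  rw [collapseMap, dif_pos h, hθ h.choose_spec]

theorem collapseMap_of_notMem {X W E : Type*} {θ : E → X} (j : E → W) (b : W) {x : X}
    (hx : x ∉ range θ) : collapseMap θ j b x = b :=
  dif_neg hx

theorem isQuotientMap_collapseMap {X W E : Type*} [TopologicalSpace X] [TopologicalSpace W]
    [TopologicalSpace E] [CompactSpace X] [T2Space X] {θ : E → X} {j : E → W} {b : W}
    (hθ : IsOpenEmbedding θ) (hne : (range θ)ᶜ.Nonempty) (hjr : range j = {b}ᶜ)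
    (hjo : IsOpenMap j)
    (hjc : ∀ C, IsCompact C → IsClosed (j '' C))
    (hjp : ∀ U, IsOpen U → b ∈ U → IsCompact (j ⁻¹' Uᶜ))
    (hjcont : Continuous j) :
    IsQuotientMap (collapseMap θ j b) := by
  have hfθ := collapseMap_apply hθ.injective j b
  have hfb : ∀ x, x ∉ range θ → collapseMap θ j b x = b :=
    fun x => collapseMap_of_notMem j b
  set f := collapseMap θ j b with hf
  have hjb : ∀ e, j e ≠ b := fun e => by
    have : j e ∈ range j := ⟨e, rfl⟩
    rw [hjr] at this
    exact this
  have hsurj : Function.Surjective f := by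
    intro w
    by_cases hw : w = b
    · obtain ⟨x, hx⟩ := hne
      exact ⟨x, by rw [hfb x hx, hw]⟩
    · have : w ∈ range j := by rw [hjr]; exact hw
      obtain ⟨e, rfl⟩ := this
      exact ⟨θ e, hfθ e⟩
  have hpre : ∀ S : Set W, b ∉ S → f ⁻¹' S = θ '' (j ⁻¹' S) := by
    intro S hS
    ext x
    constructor
    · intro hx
      by_cases h : x ∈ range θ
      · obtain ⟨e, rfl⟩ := h
        exact ⟨e, by simpa [hfθ] using hx, rfl⟩
      · rw [mem_preimage, hfb x h] at hx
        exact absurd hx hS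
    · rintro ⟨e, he, rfl⟩
      simpa [hfθ] using he
  refine (isQuotientMap_iff f).mpr
    ⟨.of_isOpen_preimage_iff_isOpen fun U => ⟨fun hU => ?_, fun hU => ?_⟩, hsurj⟩
  rotate_left
  · by_cases hb : b ∈ U
    · rw [← isClosed_compl_iff, ← preimage_compl, hpre Uᶜ (fun h => h hb)]
      exact ((hjp U hU hb).image hθ.continuous).isClosed
    · rw [hpre _ hb]
      exact hθ.isOpenMap _ (hU.preimage hjcont)
  · by_cases hb : b ∈ U
    · have h1 : IsCompact (θ '' (j ⁻¹' Uᶜ)) := by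
        rw [← hpre Uᶜ (fun h => h hb), preimage_compl]
        exact hU.isClosed_compl.isCompact
      have h2 := hjc _ (hθ.isInducing.isCompact_iff.mpr h1)
      rw [image_preimage_eq_of_subset, isClosed_compl_iff] at h2
      · exact h2
      · rw [hjr]
        rintro w hw rfl
        exact hw hb
    · rw [hpre _ hb] at hU
      have h2 := hjo _ (hU.preimage hθ.continuous)
      rw [preimage_image_eq _ hθ.injective, image_preimage_eq_of_subset] at h2
      · exact h2
      · rw [hjr]
        rintro w hw rfl
        exact hb hw

/-- A quotient map that identifies a subset `D` to a point and is injective otherwise is a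
homotopy equivalence as soon as the identity is homotopic, through maps preserving `D`, to a map
which is constant on `D`. -/
theorem nonempty_homotopyEquiv_of_isQuotientMap {X W : Type*} [TopologicalSpace X]
    [TopologicalSpace W] {f : X → W} (hf : IsQuotientMap f) (D : Set X)
    (hfD : ∀ x y, f x = f y → x = y ∨ x ∈ D ∧ y ∈ D) {b : W} (hfb : ∀ x ∈ D, f x = b)
    (G : unitInterval × X → X) (hG : Continuous G) (hG0 : ∀ x, G (0, x) = x)
    (hGD : ∀ t, ∀ x ∈ D, G (t, x) ∈ D) {d : X} (hG1 : ∀ x ∈ D, G (1, x) = d) :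
    Nonempty (ContinuousMap.HomotopyEquiv X W) := by
  let F : C(X, W) := ⟨f, hf.continuous⟩
  let G₁ : C(X, X) := ⟨fun x => G (1, x), by fun_prop⟩
  have hF : IsQuotientMap F := hf
  have hg : ∀ x y, F x = F y → G₁ x = G₁ y := by
    intro x y h
    rcases hfD x y h with rfl | ⟨hx, hy⟩
    · rfl
    · exact (hG1 x hx).trans (hG1 y hy).symm
  let g : C(W, X) := hF.lift G₁ (fun x y h => hg x y h)
  have hgf : ∀ x, g (f x) = G (1, x) := fun x =>
    congrArg (fun φ : C(X, X) => φ x) (hF.lift_comp G₁ (fun x y h => hg x y h))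
  have hGf : ∀ t x y, f x = f y → f (G (t, x)) = f (G (t, y)) := by
    intro t x y h
    rcases hfD x y h with rfl | ⟨hx, hy⟩
    · rfl
    · rw [hfb _ (hGD t x hx), hfb _ (hGD t y hy)]
  let s : W → X := Function.surjInv hf.surjective
  have hs : ∀ w, f (s w) = w := Function.surjInv_eq hf.surjective
  let H : unitInterval × W → W := fun p => f (G (p.1, s p.2))
  have hH : ∀ t x, H (t, f x) = f (G (t, x)) := fun t x => hGf t _ _ (hs (f x))
  have hHc : Continuous H := by
    refine hf.continuous_lift_prod_right ?_
    have : (fun p : unitInterval × X => H (p.1, f p.2)) = fun p => f (G p) := by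
      funext p
      exact hH p.1 p.2
    rw [this]
    exact hf.continuous.comp hG
  refine ⟨⟨F, g, ⟨ContinuousMap.Homotopy.symm ⟨⟨G, hG⟩, fun x => hG0 x, fun x => (hgf x).symm⟩⟩,
    ⟨ContinuousMap.Homotopy.symm ⟨⟨H, hHc⟩, fun w => ?_, fun w => ?_⟩⟩⟩⟩
  · change f (G (0, s w)) = w
    rw [hG0, hs]
  · obtain ⟨x, rfl⟩ := hf.surjective w
    change H (1, f x) = f (g (f x))
    rw [hH, hgf]

end Collapse

section Wedge

open Set Topology

theorem fact_finrank_euclideanSpace (n : ℕ) :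
    Fact (Module.finrank ℝ (EuclideanSpace ℝ (Fin (n + 1))) = n + 1) :=
  ⟨finrank_euclideanSpace_fin⟩

attribute [local instance] fact_finrank_euclideanSpace

/-- The parametrisation of the punctured sphere inverse to stereographic projection from the
basepoint. -/
noncomputable def SphereD.chart (n : ℕ) (v : EuclideanSpace ℝ (Fin n)) : SphereD n :=
  (stereographic' (E := EuclideanSpace ℝ (Fin (n + 1))) n (SphereD.pt n)).symm v

theorem SphereD.isOpenEmbedding_chart (n : ℕ) : IsOpenEmbedding (SphereD.chart n) :=
  OpenPartialHomeomorph.isOpenEmbedding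
    (stereographic' (E := EuclideanSpace ℝ (Fin (n + 1))) n (SphereD.pt n)).symm
    (by rw [OpenPartialHomeomorph.symm_source, stereographic'_target])

theorem SphereD.range_chart (n : ℕ) : range (SphereD.chart n) = {SphereD.pt n}ᶜ := by
  rw [← stereographic'_source (n := n), ← OpenPartialHomeomorph.symm_image_target_eq_source,
    stereographic'_target, image_univ]
  rfl

theorem SphereD.chart_ne (n : ℕ) (v : EuclideanSpace ℝ (Fin n)) :
    SphereD.chart n v ≠ SphereD.pt n := by
  have : SphereD.chart n v ∈ range (SphereD.chart n) := ⟨v, rfl⟩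
  rw [SphereD.range_chart] at this
  exact this

/-- The disjoint union of Euclidean spaces parametrising the complement of the basepoint in a
wedge of spheres. -/
noncomputable def wedgeChart (ι : Type*) (n : ℕ)
    (e : Σ _ : ι, EuclideanSpace ℝ (Fin n)) : WedgeOfSpheres (fun _ : ι => n) :=
  Quot.mk _ (Sum.inl ⟨e.1, SphereD.chart n e.2⟩)

/-- The basepoint of a wedge of spheres. -/
noncomputable def wedgeBase (ι : Type*) (n : ℕ) : WedgeOfSpheres (fun _ : ι => n) :=
  Quot.mk _ (Sum.inr ())

theorem mk_pt_eq_wedgeBase {ι : Type*} {n : ℕ} (i : ι) :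
    (Quot.mk _ (Sum.inl ⟨i, SphereD.pt n⟩) : WedgeOfSpheres (fun _ : ι => n)) = wedgeBase ι n :=
  Quot.sound ⟨.inr ⟨i, rfl⟩, .inl rfl⟩

/-- The coordinate of a point of a wedge of spheres away from the basepoint. -/
noncomputable def wedgeCoord (ι : Type*) (n : ℕ) :
    WedgeOfSpheres (fun _ : ι => n) → Option (Σ _ : ι, SphereD n) :=
  open Classical in
  Quot.lift (Sum.elim (fun p => if p.2 = SphereD.pt n then none else some p) fun _ => none) (by
    have key : ∀ p : (Σ _ : ι, SphereD n) ⊕ Unit,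
        (p = Sum.inr () ∨ ∃ i, p = Sum.inl ⟨i, SphereD.pt n⟩) →
        Sum.elim (fun p => if p.2 = SphereD.pt n then none else some p) (fun _ => none) p
          = none := by
      rintro p (rfl | ⟨i, rfl⟩) <;> simp
    rintro p q ⟨hp, hq⟩
    rw [key p hp, key q hq])

theorem wedgeCoord_wedgeChart {ι : Type*} {n : ℕ} (e : Σ _ : ι, EuclideanSpace ℝ (Fin n)) :
    wedgeCoord ι n (wedgeChart ι n e) = some ⟨e.1, SphereD.chart n e.2⟩ :=
  if_neg (SphereD.chart_ne n e.2)

theorem wedgeChart_injective (ι : Type*) (n : ℕ) : Function.Injective (wedgeChart ι n) := by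
  rintro ⟨i, v⟩ ⟨i', v'⟩ h
  have := congrArg (wedgeCoord ι n) h
  rw [wedgeCoord_wedgeChart, wedgeCoord_wedgeChart] at this
  obtain ⟨h1, h2⟩ := Sigma.mk.inj (Option.some.inj this)
  exact Sigma.ext h1 (heq_of_eq ((SphereD.isOpenEmbedding_chart n).injective (eq_of_heq h2)))

theorem range_wedgeChart (ι : Type*) (n : ℕ) : range (wedgeChart ι n) = {wedgeBase ι n}ᶜ := by
  ext w
  constructor
  · rintro ⟨e, rfl⟩ h
    have := congrArg (wedgeCoord ι n) h
    rw [wedgeCoord_wedgeChart] at this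
    exact Option.some_ne_none _ this
  · intro hw
    induction w using Quot.ind with | mk p =>
    rcases p with ⟨i, s⟩ | ⟨⟩
    · have hs : s ∈ range (SphereD.chart n) := by
        rw [SphereD.range_chart]
        rintro rfl
        exact hw (mk_pt_eq_wedgeBase i)
      obtain ⟨v, rfl⟩ := hs
      exact ⟨⟨i, v⟩, rfl⟩
    · exact absurd rfl hw

theorem continuous_wedgeChart (ι : Type*) (n : ℕ) : Continuous (wedgeChart ι n) := by
  refine continuous_quot_mk.comp (continuous_inl.comp ?_)
  exact continuous_sigma fun i =>
    continuous_sigmaMk.comp (SphereD.isOpenEmbedding_chart n).continuous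

theorem preimage_wedgeChart_image {ι : Type*} {n : ℕ}
    (C : Set (Σ _ : ι, EuclideanSpace ℝ (Fin n))) (i : ι) :
    {s : SphereD n | (Quot.mk _ (Sum.inl ⟨i, s⟩) : WedgeOfSpheres (fun _ : ι => n)) ∈
      wedgeChart ι n '' C} = SphereD.chart n '' ((fun v => ⟨i, v⟩) ⁻¹' C) := by
  ext s
  constructor
  · rintro ⟨⟨i', v⟩, hv, h⟩
    by_cases hs : s = SphereD.pt n
    · rw [hs, mk_pt_eq_wedgeBase] at h
      have : wedgeChart ι n ⟨i', v⟩ ∈ range (wedgeChart ι n) := ⟨_, rfl⟩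
      rw [range_wedgeChart] at this
      exact absurd h this
    · have hs' : s ∈ range (SphereD.chart n) := by
        rw [SphereD.range_chart]
        exact hs
      obtain ⟨v', rfl⟩ := hs'
      have := wedgeChart_injective ι n (a₁ := ⟨i', v⟩) (a₂ := ⟨i, v'⟩) h
      rw [this] at hv
      exact ⟨v', hv, rfl⟩
  · rintro ⟨v, hv, rfl⟩
    exact ⟨_, hv, rfl⟩

theorem isOpen_wedge_iff {ι : Type*} {n : ℕ} {U : Set (WedgeOfSpheres (fun _ : ι => n))} :
    IsOpen U ↔ ∀ i, IsOpen {s : SphereD n |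
      (Quot.mk _ (Sum.inl ⟨i, s⟩) : WedgeOfSpheres (fun _ : ι => n)) ∈ U} := by
  rw [← isQuotientMap_quot_mk.isOpen_preimage, isOpen_sum_iff, isOpen_sigma_iff]
  exact ⟨fun h => h.1, fun h => ⟨h, isOpen_discrete _⟩⟩

theorem isOpenMap_wedgeChart (ι : Type*) (n : ℕ) : IsOpenMap (wedgeChart ι n) := by
  intro O hO
  rw [isOpen_wedge_iff]
  intro i
  rw [preimage_wedgeChart_image]
  exact (SphereD.isOpenEmbedding_chart n).isOpenMap _ (hO.preimage continuous_sigmaMk)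

theorem isClosed_wedgeChart_image {ι : Type*} {n : ℕ}
    {C : Set (Σ _ : ι, EuclideanSpace ℝ (Fin n))} (hC : IsCompact C) :
    IsClosed (wedgeChart ι n '' C) := by
  rw [← isOpen_compl_iff, isOpen_wedge_iff]
  intro i
  have := congrArg compl (preimage_wedgeChart_image C i)
  change IsOpen {s : SphereD n | (Quot.mk _ (Sum.inl ⟨i, s⟩) : WedgeOfSpheres (fun _ : ι => n)) ∈
      wedgeChart ι n '' C}ᶜ
  rw [this, isOpen_compl_iff]
  exact ((IsClosedEmbedding.sigmaMk.isCompact_preimage hC).image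
    (SphereD.isOpenEmbedding_chart n).continuous).isClosed

theorem isCompact_wedgeChart_preimage {ι : Type*} [Finite ι] {n : ℕ}
    {U : Set (WedgeOfSpheres (fun _ : ι => n))} (hU : IsOpen U) (hb : wedgeBase ι n ∈ U) :
    IsCompact (wedgeChart ι n ⁻¹' Uᶜ) := by
  have h : wedgeChart ι n ⁻¹' Uᶜ = ⋃ i, Sigma.mk i '' (SphereD.chart n ⁻¹'
      {s : SphereD n | (Quot.mk _ (Sum.inl ⟨i, s⟩) : WedgeOfSpheres (fun _ : ι => n)) ∈ U}ᶜ) := by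
    ext ⟨i, v⟩
    simp only [mem_preimage, mem_iUnion]
    constructor
    · intro h
      exact ⟨i, v, h, rfl⟩
    · rintro ⟨i', v', h, h'⟩
      rw [← h']
      exact h
  rw [h]
  refine isCompact_iUnion fun i => IsCompact.image ?_ continuous_sigmaMk
  rw [(SphereD.isOpenEmbedding_chart n).isInducing.isCompact_iff, image_preimage_eq_of_subset]
  · exact (isOpen_wedge_iff.mp hU i).isClosed_compl.isCompact
  · rw [SphereD.range_chart]
    rintro s hs rfl
    refine hs ?_
    change (Quot.mk _ (Sum.inl ⟨i, SphereD.pt n⟩) : WedgeOfSpheres (fun _ : ι => n)) ∈ U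
    rwa [mk_pt_eq_wedgeBase]

theorem nonempty_homotopyEquiv_wedge {X ι : Type*} [TopologicalSpace X] [CompactSpace X]
    [T2Space X] [Finite ι] {n : ℕ} {θ : (Σ _ : ι, EuclideanSpace ℝ (Fin n)) → X}
    (hθ : IsOpenEmbedding θ) (G : unitInterval × X → X) (hG : Continuous G)
    (hG0 : ∀ x, G (0, x) = x) (hGD : ∀ t, ∀ x ∉ range θ, G (t, x) ∉ range θ) {d : X}
    (hd : d ∉ range θ) (hG1 : ∀ x ∉ range θ, G (1, x) = d) :
    Nonempty (ContinuousMap.HomotopyEquiv X (WedgeOfSpheres (fun _ : ι => n))) := by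
  have hq := isQuotientMap_collapseMap hθ ⟨d, hd⟩ (range_wedgeChart ι n)
    (isOpenMap_wedgeChart ι n) (fun _ => isClosed_wedgeChart_image)
    (fun _ => isCompact_wedgeChart_preimage) (continuous_wedgeChart ι n)
  have hne : ∀ e, wedgeChart ι n e ≠ wedgeBase ι n := fun e => by
    have : wedgeChart ι n e ∈ range (wedgeChart ι n) := ⟨e, rfl⟩
    rw [range_wedgeChart] at this
    exact this
  refine nonempty_homotopyEquiv_of_isQuotientMap hq (range θ)ᶜ ?_
    (fun x hx => collapseMap_of_notMem _ _ hx) G hG hG0 hGD hG1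
  intro x y h
  by_cases hx : x ∈ range θ <;> by_cases hy : y ∈ range θ
  · obtain ⟨e, rfl⟩ := hx
    obtain ⟨e', rfl⟩ := hy
    rw [collapseMap_apply hθ.injective, collapseMap_apply hθ.injective] at h
    exact .inl (congrArg θ (wedgeChart_injective ι n h))
  · obtain ⟨e, rfl⟩ := hx
    rw [collapseMap_apply hθ.injective, collapseMap_of_notMem _ _ hy] at h
    exact absurd h (hne e)
  · obtain ⟨e, rfl⟩ := hy
    rw [collapseMap_apply hθ.injective, collapseMap_of_notMem _ _ hx] at h
    exact absurd h.symm (hne e)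
  · exact .inr ⟨hx, hy⟩

end Wedge

section Realization

theorem mem_realization_iff {α : Type*} [Fintype α] {K : Set (Finset α)}
    (hK : ∀ s ∈ K, ∀ t ⊆ s, t ∈ K) (f : α → ℝ) :
    ((∀ a, 0 ≤ f a) ∧ ∃ s ∈ K, (∀ a, f a ≠ 0 → a ∈ s) ∧ ∑ a ∈ s, f a = 1) ↔
      (∀ a, 0 ≤ f a) ∧ Finset.univ.filter (fun a => f a ≠ 0) ∈ K ∧ ∑ a, f a = 1 := by
  refine and_congr_right fun _ => ⟨?_, ?_⟩
  · rintro ⟨s, hs, h1, h2⟩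
    refine ⟨hK s hs _ fun a ha => h1 a (by simpa using ha), ?_⟩
    rw [← h2]
    refine (Finset.sum_subset (Finset.subset_univ s) fun a _ ha => ?_).symm
    by_contra h
    exact ha (h1 a h)
  · rintro ⟨h1, h2⟩
    refine ⟨_, h1, fun a ha => by simpa using ha, ?_⟩
    rw [Finset.sum_filter_ne_zero, h2]

theorem compactSpace_realization {α : Type*} [Fintype α] (K : Set (Finset α)) :
    CompactSpace (Realization K) := by
  have hfin : K.Finite := Set.toFinite K
  have hset : {f : α → ℝ | (∀ a, 0 ≤ f a) ∧ ∃ s ∈ K, (∀ a, f a ≠ 0 → a ∈ s) ∧ ∑ a ∈ s, f a = 1}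
      = ⋃ s ∈ K, Set.Icc 0 1 ∩ ((⋂ a ∈ {a | a ∉ s}, {f : α → ℝ | f a = 0}) ∩
          {f | ∑ a ∈ s, f a = 1}) := by
    ext f
    simp only [Set.mem_ofPred_eq, Set.mem_iUnion, Set.mem_inter_iff, Set.mem_iInter, exists_prop,
      Set.mem_Icc, Pi.le_def, Pi.zero_apply, Pi.one_apply]
    constructor
    · rintro ⟨h0, s, hs, h1, h2⟩
      refine ⟨s, hs, ⟨h0, fun a => ?_⟩, fun a ha => by_contra fun h => ha (h1 a h), h2⟩
      by_cases ha : a ∈ s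
      · rw [← h2]
        exact Finset.single_le_sum (fun b _ => h0 b) ha
      · rw [by_contra fun h => ha (h1 a h)]
        exact zero_le_one
    · rintro ⟨s, hs, ⟨h0, -⟩, h1, h2⟩
      exact ⟨h0, s, hs, fun a ha => by_contra fun h => ha (h1 a h), h2⟩
  suffices h : IsCompact {f : α → ℝ |
      (∀ a, 0 ≤ f a) ∧ ∃ s ∈ K, (∀ a, f a ≠ 0 → a ∈ s) ∧ ∑ a ∈ s, f a = 1} from
    isCompact_iff_compactSpace.mp h
  rw [hset]
  refine hfin.isCompact_biUnion fun s _ => isCompact_Icc.inter_right ?_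
  refine (isClosed_biInter fun a _ => ?_).inter ?_
  · exact isClosed_eq (continuous_apply a) continuous_const
  · exact isClosed_eq (by fun_prop) continuous_const

end Realization

/-- A simplicial complex whose vertices are coloured by `Fin (n + 1)`, such that a face has at
most one vertex of each colour, with a distinguished vertex `z i` of each colour `i` which can be
added to every face that has no vertex of colour `i`. -/
structure IsRainbow {α : Type*} [DecidableEq α] {n : ℕ} (K : Set (Finset α))
    (col : α → Fin (n + 1)) (z : Fin (n + 1) → α) : Prop where
  empty_mem : ∅ ∈ K
  down : ∀ s ∈ K, ∀ t ⊆ s, t ∈ K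
  injOn : ∀ s ∈ K, Set.InjOn col s
  col_z : ∀ i, col (z i) = i
  cone : ∀ s ∈ K, ∀ i, (∀ a ∈ s, col a ≠ i) → insert (z i) s ∈ K

namespace IsRainbow

variable {α : Type*} [DecidableEq α] {n : ℕ} {K : Set (Finset α)}
  {col : α → Fin (n + 1)} {z : Fin (n + 1) → α}

theorem mem_of_forall (h : IsRainbow K col z) {s t : Finset α} (hs : s ∈ K)
    (ht : Set.InjOn col t) (hst : ∀ v ∈ t, v ∈ s ∨ v = z (col v)) : t ∈ K := by
  have key : ∀ u ⊆ t \ s, (t ∩ s) ∪ u ∈ K := by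
    intro u
    induction u using Finset.induction_on with
    | empty => exact fun _ => h.down s hs _ (by simp)
    | insert v u hv ih =>
      intro hu
      have hvt : v ∈ t \ s := hu (Finset.mem_insert_self v u)
      have hus : u ⊆ t \ s := fun w hw => hu (Finset.mem_insert_of_mem hw)
      rw [Finset.mem_sdiff] at hvt
      have hvz : v = z (col v) := (hst v hvt.1).resolve_left hvt.2
      have := h.cone _ (ih hus) (col v) (by
        intro w hw hwv
        have hwt : w ∈ t := by
          rcases Finset.mem_union.mp hw with hw | hw
          · exact (Finset.mem_inter.mp hw).1
          · exact (Finset.mem_sdiff.mp (hus hw)).1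
        have hwv' : w = v := ht hwt hvt.1 hwv
        subst hwv'
        rcases Finset.mem_union.mp hw with hw | hw
        · exact hvt.2 (Finset.mem_inter.mp hw).2
        · exact hv hw)
      rwa [← hvz, ← Finset.union_insert] at this
  have := key (t \ s) subset_rfl
  rwa [Finset.union_comm, Finset.sdiff_union_inter] at this

theorem eq_of_col_eq (h : IsRainbow K col z) (x : Realization K) {v w : α} (hv : x.1 v ≠ 0)
    (hw : x.1 w ≠ 0) (hvw : col v = col w) : v = w := by
  obtain ⟨s, hs, hsx, -⟩ := x.2.2
  exact h.injOn s hs (hsx v hv) (hsx w hw) hvw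

variable [Fintype α]

/-- The total weight on the vertices of colour `i` other than `z i`. -/
noncomputable def mass (col : α → Fin (n + 1)) (z : Fin (n + 1) → α) (x : α → ℝ)
    (i : Fin (n + 1)) : ℝ :=
  ∑ a with col a = i, if a = z i then 0 else x a

/-- Scale all weights by `p`, decrease the weight of the undistinguished vertices by `q` and raise
the weight of each distinguished vertex `z i` by the amount of `q` that is not used up
in colour `i`. -/
noncomputable def push (col : α → Fin (n + 1)) (z : Fin (n + 1) → α) (p q : ℝ) (x : α → ℝ)
    (v : α) : ℝ :=
  if v = z (col v) then p * x v + max (q - p * mass col z x (col v)) 0 else max (p * x v - q) 0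

/-- A scaling factor which equals `1 - t` when some colour carries no weight on
undistinguished vertices, and is large at the barycentres of the faces without distinguished
vertices. -/
noncomputable def scale (col : α → Fin (n + 1)) (z : Fin (n + 1) → α) (t : ℝ) (x : α → ℝ) : ℝ :=
  1 - t + 2 * (n + 1) * t * ∏ i, ((n + 1) * mass col z x i)

theorem mass_nonneg {x : α → ℝ} (hx : ∀ a, 0 ≤ x a) (i : Fin (n + 1)) :
    0 ≤ mass col z x i :=
  Finset.sum_nonneg fun a _ => by split_ifs <;> simp [hx a]

theorem exists_of_mass_ne_zero {x : α → ℝ} {i : Fin (n + 1)} (hi : mass col z x i ≠ 0) :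
    ∃ v, col v = i ∧ v ≠ z i ∧ x v ≠ 0 := by
  obtain ⟨v, hv, hne⟩ := Finset.exists_ne_zero_of_sum_ne_zero hi
  have hvz : v ≠ z i := fun h => hne (if_pos h)
  exact ⟨v, (Finset.mem_filter.mp hv).2, hvz, by rwa [if_neg hvz] at hne⟩

theorem mass_eq (h : IsRainbow K col z) (x : Realization K) {v : α} (hv : v ≠ z (col v))
    (hx : x.1 v ≠ 0) : mass col z x.1 (col v) = x.1 v := by
  rw [mass, Finset.sum_eq_single v, if_neg hv]
  · intro w hw hwv
    split_ifs
    · rfl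
    · by_contra hne
      exact hwv (h.eq_of_col_eq x hne hx (Finset.mem_filter.mp hw).2)
  · simp

theorem push_nonneg {p q : ℝ} (hp : 0 ≤ p) {x : α → ℝ} (hx : ∀ a, 0 ≤ x a) (v : α) :
    0 ≤ push col z p q x v := by
  unfold push
  split_ifs
  · have := mul_nonneg hp (hx v)
    positivity
  · exact le_max_right _ _

theorem sum_realization (h : IsRainbow K col z) (x : Realization K) : ∑ a, x.1 a = 1 :=
  ((mem_realization_iff h.down x.1).mp x.2).2.2

theorem scale_nonneg {t : ℝ} (ht : 0 ≤ t) (ht1 : t ≤ 1) {x : α → ℝ} (hx : ∀ a, 0 ≤ x a) :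
    0 ≤ scale col z t x := by
  have h1 : 0 ≤ ∏ i, (((n : ℝ) + 1) * mass col z x i) :=
    Finset.prod_nonneg fun i _ => mul_nonneg (by positivity) (mass_nonneg hx i)
  have h2 : 0 ≤ 2 * ((n : ℝ) + 1) * t * ∏ i, (((n : ℝ) + 1) * mass col z x i) := by positivity
  unfold scale
  linarith

theorem sum_push_pos (h : IsRainbow K col z) {t : ℝ} (ht : 0 ≤ t) (ht1 : t ≤ 1)
    (x : Realization K) : 0 < ∑ v, push col z (scale col z t x.1) t x.1 v := by
  have hx := x.2.1
  set p := scale col z t x.1 with hp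
  have hp0 : 0 ≤ p := scale_nonneg ht ht1 hx
  have hnn := fun v => push_nonneg (col := col) (z := z) (q := t) hp0 hx v
  refine lt_of_le_of_ne (Finset.sum_nonneg fun v _ => hnn v) fun h0 => ?_
  have hz : ∀ v, push col z p t x.1 v = 0 := fun v =>
    (Finset.sum_eq_zero_iff_of_nonneg fun v _ => hnn v).mp h0.symm v (Finset.mem_univ v)
  have hzz : ∀ i, p * x.1 (z i) = 0 ∧ t ≤ p * mass col z x.1 i := by
    intro i
    have h1 := hz (z i)
    rw [push, h.col_z, if_pos rfl] at h1
    have h2 := mul_nonneg hp0 (hx (z i))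
    have h3 := le_max_right (t - p * mass col z x.1 i) 0
    have h4 := le_max_left (t - p * mass col z x.1 i) 0
    constructor <;> linarith
  have hle : ∀ i, p * mass col z x.1 i ≤ t := by
    intro i
    by_cases hi : mass col z x.1 i = 0
    · rw [hi, mul_zero]
      exact ht
    · obtain ⟨v, rfl, hvz, hv⟩ := exists_of_mass_ne_zero hi
      rw [h.mass_eq x hvz hv]
      have h1 := hz v
      rw [push, if_neg hvz] at h1
      have h2 := le_max_left (p * x.1 v - t) 0
      linarith
  have heq : ∀ i, p * mass col z x.1 i = t := fun i => le_antisymm (hle i) (hzz i).2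
  have hp1 : p ≠ 0 := by
    intro hp1
    have h1 := heq 0
    rw [hp1, zero_mul] at h1
    rw [← h1] at hp
    simp [scale, hp1] at hp
  have hmass : ∑ i, mass col z x.1 i = 1 := by
    refine Eq.trans ?_ ((Finset.sum_fiberwise Finset.univ col x.1).trans (h.sum_realization x))
    refine Finset.sum_congr rfl fun i _ => Finset.sum_congr rfl fun a _ => ?_
    split_ifs with ha
    · rw [ha]
      exact ((mul_eq_zero.mp (hzz i).1).resolve_left hp1).symm
    · rfl
  have hpt : p = (n + 1) * t := by
    have h1 : ∑ i, p * mass col z x.1 i = ∑ _i : Fin (n + 1), t :=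
      Finset.sum_congr rfl fun i _ => heq i
    rw [← Finset.mul_sum, hmass] at h1
    simpa using h1
  have ht0 : t ≠ 0 := by
    rintro rfl
    exact hp1 (by rw [hpt, mul_zero])
  have hm : ∀ i, (n + 1) * mass col z x.1 i = 1 := by
    intro i
    have h1 := heq i
    rw [hpt] at h1
    exact mul_left_cancel₀ ht0 (by linarith)
  have hfin : p = 1 - t + 2 * (n + 1) * t := by
    conv_lhs => rw [hp, scale, Finset.prod_congr rfl fun i _ => hm i]
    simp
  have hn : 0 ≤ (n : ℝ) * t := by positivity
  linarith

/-- The normalised `push`, as a map of the realization to itself. -/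
noncomputable def flow (h : IsRainbow K col z) (t : unitInterval) (x : Realization K) :
    Realization K :=
  ⟨fun v => push col z (scale col z t x.1) t x.1 v / ∑ w, push col z (scale col z t x.1) t x.1 w,
    (mem_realization_iff h.down _).mpr (by
      have hx := x.2.1
      have hp0 := scale_nonneg (col := col) (z := z) t.2.1 t.2.2 hx
      have hS := h.sum_push_pos t.2.1 t.2.2 x
      set p := scale col z t x.1 with hp
      have hnn := fun v => push_nonneg (col := col) (z := z) (q := t) hp0 hx v
      refine ⟨fun a => div_nonneg (hnn a) hS.le, ?_, ?_⟩
      · have hpos : ∀ v, v ≠ z (col v) → push col z p t x.1 v ≠ 0 →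
            x.1 v ≠ 0 ∧ (t : ℝ) < p * x.1 v := by
          intro v hv hne
          rw [push, if_neg hv] at hne
          have h1 : (t : ℝ) < p * x.1 v := by
            by_contra hle
            exact hne (max_eq_right (by linarith))
          refine ⟨fun h0 => ?_, h1⟩
          rw [h0, mul_zero] at h1
          exact absurd h1 (not_lt.mpr t.2.1)
        have hzv : ∀ v w, v = z (col v) → w ≠ z (col w) → push col z p t x.1 v ≠ 0 →
            push col z p t x.1 w ≠ 0 → col v = col w → v = w := by
          intro v w hv hw hv0 hw0 hvw
          obtain ⟨h1, h2⟩ := hpos w hw hw0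
          refine h.eq_of_col_eq x (fun h0 => hv0 ?_) h1 hvw
          rw [push, if_pos hv, hvw, h.mass_eq x hw h1, h0, mul_zero, zero_add]
          exact max_eq_right (by linarith)
        refine h.mem_of_forall ((mem_realization_iff h.down x.1).mp x.2).2.1 ?_ ?_
        · intro v hv w hw hvw
          simp only [Finset.coe_filter, Set.mem_ofPred_eq, Finset.mem_univ, true_and, ne_eq,
            div_eq_zero_iff, hS.ne', or_false] at hv hw
          by_cases hvz : v = z (col v) <;> by_cases hwz : w = z (col w)
          · rw [hvz, hwz, hvw]
          · exact hzv v w hvz hwz hv hw hvw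
          · exact (hzv w v hwz hvz hw hv hvw.symm).symm
          · exact h.eq_of_col_eq x (hpos v hvz hv).1 (hpos w hwz hw).1 hvw
        · intro v hv
          simp only [Finset.mem_filter, Finset.mem_univ, true_and, ne_eq, div_eq_zero_iff, hS.ne',
            or_false] at hv ⊢
          by_cases hvz : v = z (col v)
          · exact .inr hvz
          · exact .inl (hpos v hvz hv).1
      · rw [← Finset.sum_div, div_self hS.ne'])⟩

theorem continuous_flow (h : IsRainbow K col z) :
    Continuous fun p : unitInterval × Realization K => h.flow p.1 p.2 := by
  have hval : ∀ v, Continuous fun p : unitInterval × Realization K => p.2.1 v := fun v =>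
    (continuous_apply v).comp (continuous_subtype_val.comp continuous_snd)
  have hmass : ∀ i, Continuous fun p : unitInterval × Realization K => mass col z p.2.1 i := by
    intro i
    refine continuous_finsetSum _ fun a _ => ?_
    split_ifs
    · exact continuous_const
    · exact hval a
  have ht : Continuous fun p : unitInterval × Realization K => (p.1 : ℝ) :=
    continuous_subtype_val.comp continuous_fst
  have hscale : Continuous fun p : unitInterval × Realization K => scale col z p.1 p.2.1 := by
    have := continuous_finsetProd Finset.univ fun i (_ : i ∈ Finset.univ) =>
      (continuous_const (y := (n : ℝ) + 1)).mul (hmass i)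
    unfold scale
    fun_prop
  have hpush : ∀ v, Continuous fun p : unitInterval × Realization K =>
      push col z (scale col z p.1 p.2.1) p.1 p.2.1 v := by
    intro v
    have h1 := hval v
    have h2 := hmass (col v)
    unfold push
    split_ifs <;> fun_prop
  refine Continuous.subtype_mk (continuous_pi fun v => ?_) _
  exact (hpush v).div (continuous_finsetSum _ fun w _ => hpush w)
    fun p => (h.sum_push_pos p.1.2.1 p.1.2.2 p.2).ne'

theorem flow_zero (h : IsRainbow K col z) (x : Realization K) : h.flow 0 x = x := by
  have h1 : ∀ v, push col z (scale col z 0 x.1) 0 x.1 v = x.1 v := by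
    intro v
    have hs : scale col z 0 x.1 = 1 := by simp [scale]
    rw [push, hs]
    split_ifs with hv
    · rw [max_eq_right, one_mul, add_zero]
      have := mass_nonneg (col := col) (z := z) x.2.1 (col v)
      linarith
    · rw [one_mul, sub_zero, max_eq_left (x.2.1 v)]
  refine Subtype.ext (funext fun v => ?_)
  change push col z (scale col z 0 x.1) 0 x.1 v / ∑ w, push col z (scale col z 0 x.1) 0 x.1 w = _
  simp_rw [h1]
  rw [h.sum_realization, div_one]

theorem mass_flow_eq_zero (h : IsRainbow K col z) (t : unitInterval) (x : Realization K)
    {i : Fin (n + 1)} (hi : mass col z x.1 i = 0) : mass col z (h.flow t x).1 i = 0 := by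
  have hx : ∀ v, col v = i → v ≠ z i → x.1 v = 0 := by
    intro v hv hvz
    have := (Finset.sum_eq_zero_iff_of_nonneg fun a _ => ?_).mp hi v (by simpa using hv)
    · rwa [if_neg hvz] at this
    · split_ifs <;> simp [x.2.1 a]
  refine Finset.sum_eq_zero fun v hv => ?_
  have hv' : col v = i := (Finset.mem_filter.mp hv).2
  split_ifs with hvz
  · rfl
  · change push col z _ t x.1 v / _ = 0
    rw [push, if_neg (by rwa [hv']), hx v hv' hvz, mul_zero, max_eq_right, zero_div]
    linarith [t.2.1]

theorem flow_one (h : IsRainbow K col z) {x y : Realization K}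
    (hx : ∃ i, mass col z x.1 i = 0) (hy : ∃ i, mass col z y.1 i = 0) :
    h.flow 1 x = h.flow 1 y := by
  have key : ∀ x : Realization K, (∃ i, mass col z x.1 i = 0) → ∀ v,
      push col z (scale col z 1 x.1) 1 x.1 v = if v = z (col v) then 1 else 0 := by
    rintro x ⟨i, hi⟩ v
    have hs : scale col z 1 x.1 = 0 := by
      rw [scale, Finset.prod_eq_zero (Finset.mem_univ i) (by rw [hi, mul_zero])]
      simp
    rw [push, hs]
    split_ifs <;> simp
  refine Subtype.ext (funext fun v => ?_)
  change push col z (scale col z 1 x.1) 1 x.1 v / ∑ w, push col z (scale col z 1 x.1) 1 x.1 w =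
    push col z (scale col z 1 y.1) 1 y.1 v / ∑ w, push col z (scale col z 1 y.1) 1 y.1 w
  simp_rw [key x hx, key y hy]

end IsRainbow

namespace IsRainbow

/-- Barycentric coordinates of the interior of the `n`-simplex by Euclidean space. -/
noncomputable def softmax {n : ℕ} (v : EuclideanSpace ℝ (Fin n)) (i : Fin (n + 1)) : ℝ :=
  (Fin.cons 1 fun i => Real.exp (v i) : Fin (n + 1) → ℝ) i /
    ∑ j, (Fin.cons 1 fun i => Real.exp (v i) : Fin (n + 1) → ℝ) j

theorem cons_exp_pos {n : ℕ} (v : EuclideanSpace ℝ (Fin n)) (i : Fin (n + 1)) :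
    0 < (Fin.cons 1 fun i => Real.exp (v i) : Fin (n + 1) → ℝ) i := by
  refine Fin.cases ?_ (fun i => ?_) i
  · exact one_pos
  · exact Real.exp_pos _

theorem sum_cons_exp_pos {n : ℕ} (v : EuclideanSpace ℝ (Fin n)) :
    0 < ∑ j, (Fin.cons 1 fun i => Real.exp (v i) : Fin (n + 1) → ℝ) j :=
  Finset.sum_pos (fun i _ => cons_exp_pos v i) Finset.univ_nonempty

theorem softmax_pos {n : ℕ} (v : EuclideanSpace ℝ (Fin n)) (i : Fin (n + 1)) :
    0 < softmax v i :=
  div_pos (cons_exp_pos v i) (sum_cons_exp_pos v)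

theorem sum_softmax {n : ℕ} (v : EuclideanSpace ℝ (Fin n)) : ∑ i, softmax v i = 1 := by
  unfold softmax
  rw [← Finset.sum_div, div_self (sum_cons_exp_pos v).ne']

theorem continuous_softmax {n : ℕ} (i : Fin (n + 1)) :
    Continuous fun v : EuclideanSpace ℝ (Fin n) => softmax v i := by
  have h : ∀ i, Continuous fun v : EuclideanSpace ℝ (Fin n) =>
      (Fin.cons 1 fun i => Real.exp (v i) : Fin (n + 1) → ℝ) i := by
    intro i
    refine Fin.cases ?_ (fun i => ?_) i
    · simpa using continuous_const
    · simp only [Fin.cons_succ]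
      fun_prop
  exact (h i).div (continuous_finsetSum _ fun j _ => h j) fun v => (sum_cons_exp_pos v).ne'

/-- The logarithmic coordinates inverse to `softmax`. -/
noncomputable def logRatio {n : ℕ} (y : Fin (n + 1) → ℝ) : EuclideanSpace ℝ (Fin n) :=
  WithLp.toLp 2 fun i => Real.log (y i.succ / y 0)

theorem logRatio_softmax {n : ℕ} (v : EuclideanSpace ℝ (Fin n)) : logRatio (softmax v) = v := by
  ext i
  change Real.log (softmax v i.succ / softmax v 0) = v i
  unfold softmax
  rw [div_div_div_cancel_right₀ (sum_cons_exp_pos v).ne', Fin.cons_succ, Fin.cons_zero, div_one,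
    Real.log_exp]

theorem softmax_logRatio {n : ℕ} {y : Fin (n + 1) → ℝ} (hy : ∀ i, 0 < y i) (h1 : ∑ i, y i = 1) :
    softmax (logRatio y) = y := by
  have h : (Fin.cons 1 fun i => Real.exp (logRatio y i) : Fin (n + 1) → ℝ) = fun i => y i / y 0 := by
    funext i
    refine Fin.cases ?_ (fun i => ?_) i
    · rw [Fin.cons_zero, div_self (hy 0).ne']
    · rw [Fin.cons_succ]
      exact Real.exp_log (div_pos (hy _) (hy 0))
  funext i
  rw [softmax, h, ← Finset.sum_div, h1, div_div_div_cancel_right₀ (hy 0).ne', div_one]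

theorem continuousOn_logRatio {n : ℕ} :
    ContinuousOn (logRatio (n := n)) {y | ∀ i, y i ≠ 0} := by
  refine (PiLp.continuous_toLp 2 _).comp_continuousOn (continuousOn_pi.mpr fun i => ?_)
  refine ContinuousOn.log ?_ fun y hy => div_ne_zero (hy _) (hy 0)
  exact (continuous_apply _).continuousOn.div (continuous_apply _).continuousOn fun y hy => hy 0

theorem continuous_apply_realization {α : Type*} {K : Set (Finset α)} (a : α) :
    Continuous fun x : Realization K => x.1 a :=
  (continuous_apply a).comp continuous_subtype_val

variable {α : Type*} [DecidableEq α] {n : ℕ} {K : Set (Finset α)}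
  {col : α → Fin (n + 1)} {z : Fin (n + 1) → α}

/-- The faces with a vertex of every colour and without distinguished vertices. -/
def Facets (K : Set (Finset α)) (z : Fin (n + 1) → α) : Set (Finset α) :=
  {s | s ∈ K ∧ s.card = n + 1 ∧ ∀ i, z i ∉ s}

theorem image_col (h : IsRainbow K col z) {s : Finset α} (hs : s ∈ Facets K z) :
    s.image col = Finset.univ := by
  rw [← Finset.card_eq_iff_eq_univ, Finset.card_image_of_injOn (h.injOn s hs.1), hs.2.1,
    Fintype.card_fin]

theorem exists_mem_col_eq (h : IsRainbow K col z) {s : Finset α} (hs : s ∈ Facets K z)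
    (i : Fin (n + 1)) : ∃ a ∈ s, col a = i := by
  have : i ∈ s.image col := by rw [h.image_col hs]; exact Finset.mem_univ i
  exact Finset.mem_image.mp this

theorem sum_comp_col (h : IsRainbow K col z) {s : Finset α} (hs : s ∈ Facets K z)
    (y : Fin (n + 1) → ℝ) : ∑ a ∈ s, y (col a) = ∑ i, y i := by
  rw [← h.image_col hs, Finset.sum_image (h.injOn s hs.1)]

/-- The parametrisation of the interior of a facet by Euclidean space. -/
noncomputable def facetPoint (h : IsRainbow K col z) {s : Finset α} (hs : s ∈ Facets K z)
    (v : EuclideanSpace ℝ (Fin n)) : Realization K :=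
  ⟨fun a => if a ∈ s then softmax v (col a) else 0, by
    refine ⟨fun a => ?_, s, hs.1, fun a ha => by_contra fun h => ha (if_neg h), ?_⟩
    · dsimp only
      split_ifs
      · exact (softmax_pos v _).le
      · exact le_rfl
    · rw [Finset.sum_congr rfl fun a ha => if_pos ha, h.sum_comp_col hs, sum_softmax]⟩

theorem facetPoint_apply_of_mem (h : IsRainbow K col z) {s : Finset α} (hs : s ∈ Facets K z)
    (v : EuclideanSpace ℝ (Fin n)) {a : α} (ha : a ∈ s) :
    (h.facetPoint hs v).1 a = softmax v (col a) :=
  if_pos ha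

theorem facetPoint_ne_zero (h : IsRainbow K col z) {s : Finset α} (hs : s ∈ Facets K z)
    (v : EuclideanSpace ℝ (Fin n)) {a : α} (ha : a ∈ s) : (h.facetPoint hs v).1 a ≠ 0 := by
  rw [h.facetPoint_apply_of_mem hs v ha]
  exact (softmax_pos v _).ne'

theorem continuous_facetPoint (h : IsRainbow K col z) {s : Finset α} (hs : s ∈ Facets K z) :
    Continuous (h.facetPoint hs) := by
  refine Continuous.subtype_mk (continuous_pi fun a => ?_) _
  split_ifs
  · exact continuous_softmax _
  · exact continuous_const

variable [Fintype α]

theorem mass_eq_of_mem_facet (h : IsRainbow K col z) {s : Finset α} (hs : s ∈ Facets K z)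
    {x : Realization K} {a : α} (ha : a ∈ s) (hx : x.1 a ≠ 0) :
    mass col z x.1 (col a) = x.1 a :=
  h.mass_eq x (fun haz => hs.2.2 (col a) (haz ▸ ha)) hx

theorem mass_facetPoint (h : IsRainbow K col z) {s : Finset α} (hs : s ∈ Facets K z)
    (v : EuclideanSpace ℝ (Fin n)) : mass col z (h.facetPoint hs v).1 = softmax v := by
  funext i
  obtain ⟨a, ha, rfl⟩ := h.exists_mem_col_eq hs i
  rw [h.mass_eq_of_mem_facet hs ha (h.facetPoint_ne_zero hs v ha),
    h.facetPoint_apply_of_mem hs v ha]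

theorem facetPoint_logRatio_mass (h : IsRainbow K col z) {s : Finset α} (hs : s ∈ Facets K z)
    {x : Realization K} (hx : ∀ a ∈ s, x.1 a ≠ 0) :
    h.facetPoint hs (logRatio (mass col z x.1)) = x := by
  have hm : ∀ a ∈ s, mass col z x.1 (col a) = x.1 a := fun a ha =>
    h.mass_eq_of_mem_facet hs ha (hx a ha)
  have hpos : ∀ i, 0 < mass col z x.1 i := by
    intro i
    obtain ⟨a, ha, rfl⟩ := h.exists_mem_col_eq hs i
    rw [hm a ha]
    exact lt_of_le_of_ne (x.2.1 a) (hx a ha).symm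
  have hout : ∀ a ∉ s, x.1 a = 0 := by
    intro a ha
    by_contra hne
    obtain ⟨b, hb, hba⟩ := h.exists_mem_col_eq hs (col a)
    exact ha (h.eq_of_col_eq x hne (hx b hb) hba.symm ▸ hb)
  have hsum : ∑ i, mass col z x.1 i = 1 := by
    rw [← h.sum_comp_col hs, Finset.sum_congr rfl hm]
    refine Eq.trans ?_ (h.sum_realization x)
    exact Finset.sum_subset (Finset.subset_univ s) fun a _ ha => hout a ha
  refine Subtype.ext (funext fun a => ?_)
  by_cases ha : a ∈ s
  · rw [h.facetPoint_apply_of_mem hs _ ha, softmax_logRatio hpos hsum, hm a ha]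
  · rw [hout a ha]
    exact if_neg ha

theorem exists_facet (h : IsRainbow K col z) {x : Realization K}
    (hx : ∀ i, mass col z x.1 i ≠ 0) : ∃ s ∈ Facets K z, ∀ a ∈ s, x.1 a ≠ 0 := by
  have hs := ((mem_realization_iff h.down x.1).mp x.2).2.1
  refine ⟨_, ⟨hs, ?_, ?_⟩, fun a ha => (Finset.mem_filter.mp ha).2⟩
  · rw [← Finset.card_image_of_injOn (h.injOn _ hs)]
    refine ((Finset.card_eq_iff_eq_univ _).mpr (Finset.eq_univ_iff_forall.mpr fun i => ?_)).trans
      (Fintype.card_fin _)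
    obtain ⟨v, hv, -, hv0⟩ := exists_of_mass_ne_zero (hx i)
    exact Finset.mem_image.mpr ⟨v, by simpa using hv0, hv⟩
  · intro i hi
    obtain ⟨v, hv, hvz, hv0⟩ := exists_of_mass_ne_zero (hx i)
    exact hvz (h.eq_of_col_eq x hv0 (Finset.mem_filter.mp hi).2 (by rw [hv, h.col_z]))

theorem continuous_mass :
    Continuous fun x : Realization K => mass col z x.1 := by
  refine continuous_pi fun i => continuous_finsetSum _ fun a _ => ?_
  split_ifs
  · exact continuous_const
  · exact continuous_apply_realization a

theorem isOpenMap_facetPoint (h : IsRainbow K col z) {s : Finset α} (hs : s ∈ Facets K z) :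
    IsOpenMap (h.facetPoint hs) := by
  intro O hO
  have himage : h.facetPoint hs '' O =
      {x | ∀ a ∈ s, x.1 a ≠ 0} ∩ (fun x => logRatio (mass col z x.1)) ⁻¹' O := by
    ext x
    constructor
    · rintro ⟨v, hv, rfl⟩
      refine ⟨fun a ha => h.facetPoint_ne_zero hs v ha, ?_⟩
      rwa [Set.mem_preimage, h.mass_facetPoint, logRatio_softmax]
    · rintro ⟨hx, hxO⟩
      exact ⟨_, hxO, h.facetPoint_logRatio_mass hs hx⟩
  rw [himage]
  refine ContinuousOn.isOpen_inter_preimage ?_ ?_ hO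
  · refine continuousOn_logRatio.comp continuous_mass.continuousOn fun x hx i => ?_
    obtain ⟨a, ha, rfl⟩ := h.exists_mem_col_eq hs i
    rw [h.mass_eq_of_mem_facet hs ha (hx a ha)]
    exact hx a ha
  · have : {x : Realization K | ∀ a ∈ s, x.1 a ≠ 0} = ⋂ a ∈ s, {x | x.1 a ≠ 0} := by
      ext x
      simp
    rw [this]
    exact isOpen_biInter_finset fun a _ =>
      isOpen_ne_fun (continuous_apply_realization a) continuous_const

/-- The parametrisation of the union of the interiors of all facets. -/
noncomputable def facetsChart {ι : Type*} (h : IsRainbow K col z) (e : ι ≃ Facets K z)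
    (p : Σ _ : ι, EuclideanSpace ℝ (Fin n)) : Realization K :=
  h.facetPoint (e p.1).2 p.2

theorem isOpenEmbedding_facetsChart {ι : Type*} (h : IsRainbow K col z) (e : ι ≃ Facets K z) :
    Topology.IsOpenEmbedding (h.facetsChart e) := by
  refine .of_continuous_injective_isOpenMap ?_ ?_ ?_
  · exact continuous_sigma fun i => h.continuous_facetPoint (e i).2
  · have hsub : ∀ p q, h.facetsChart e p = h.facetsChart e q → (e p.1).1 ⊆ (e q.1).1 := by
      intro p q hpq a ha
      by_contra hne
      refine h.facetPoint_ne_zero (e p.1).2 p.2 ha ?_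
      exact (congrFun (congrArg Subtype.val hpq) a).trans (if_neg hne)
    intro p q hpq
    refine Sigma.ext (e.injective (Subtype.ext ((hsub p q hpq).antisymm (hsub q p hpq.symm))))
      (heq_of_eq ?_)
    rw [← logRatio_softmax p.2, ← logRatio_softmax q.2, ← h.mass_facetPoint (e p.1).2,
      ← h.mass_facetPoint (e q.1).2]
    exact congrArg (fun x : Realization K => logRatio (mass col z x.1)) hpq
  · exact isOpenMap_sigma.mpr fun i => h.isOpenMap_facetPoint (e i).2

theorem notMem_range_facetsChart {ι : Type*} (h : IsRainbow K col z) (e : ι ≃ Facets K z)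
    (x : Realization K) : x ∉ Set.range (h.facetsChart e) ↔ ∃ i, mass col z x.1 i = 0 := by
  rw [← not_iff_not, not_not]
  push Not
  constructor
  · rintro ⟨p, rfl⟩ i
    rw [facetsChart, h.mass_facetPoint]
    exact (softmax_pos _ _).ne'
  · intro hx
    obtain ⟨s, hs, hsx⟩ := h.exists_facet hx
    refine ⟨⟨e.symm ⟨s, hs⟩, logRatio (mass col z x.1)⟩, ?_⟩
    have key : ∀ t : Facets K z, t = ⟨s, hs⟩ →
        h.facetPoint t.2 (logRatio (mass col z x.1)) = x := by
      rintro _ rfl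
      exact h.facetPoint_logRatio_mass hs hsx
    exact key _ (e.apply_symm_apply _)

/-- A vertex of the realization at a distinguished vertex. -/
noncomputable def zPoint (h : IsRainbow K col z) : Realization K :=
  ⟨fun a => if a = z 0 then 1 else 0, by
    refine ⟨fun a => ?_, {z 0}, h.cone ∅ h.empty_mem 0 (by simp), fun a ha => ?_, by simp⟩
    · dsimp only
      split_ifs
      · exact zero_le_one
      · exact le_rfl
    · exact Finset.mem_singleton.mpr (by_contra fun hne => ha (if_neg hne))⟩

theorem mass_zPoint (h : IsRainbow K col z) : mass col z h.zPoint.1 0 = 0 := by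
  refine Finset.sum_eq_zero fun a _ => ?_
  split_ifs with ha
  · rfl
  · exact if_neg ha

theorem nonempty_homotopyEquiv {ι : Type*} [Finite ι] (h : IsRainbow K col z)
    (e : ι ≃ Facets K z) :
    Nonempty (ContinuousMap.HomotopyEquiv (Realization K) (WedgeOfSpheres (fun _ : ι => n))) := by
  have := compactSpace_realization K
  have hz : ∃ i, mass col z h.zPoint.1 i = 0 := ⟨0, h.mass_zPoint⟩
  refine nonempty_homotopyEquiv_wedge (h.isOpenEmbedding_facetsChart e)
    (fun p => h.flow p.1 p.2) h.continuous_flow h.flow_zero ?_ (d := h.flow 1 h.zPoint) ?_ ?_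
  · intro t x hx
    rw [notMem_range_facetsChart] at hx ⊢
    obtain ⟨i, hi⟩ := hx
    exact ⟨i, h.mass_flow_eq_zero t x hi⟩
  · rw [notMem_range_facetsChart]
    exact ⟨0, h.mass_flow_eq_zero 1 _ h.mass_zPoint⟩
  · intro x hx
    exact h.flow_one ((h.notMem_range_facetsChart e x).mp hx) hz

end IsRainbow

theorem Finset.sort_insert_of_forall_lt {s : Finset ℕ} {x : ℕ} (hx : ∀ y ∈ s, y < x) :
    (insert x s).sort (· ≤ ·) = s.sort (· ≤ ·) ++ [x] := by
  have hxs : x ∉ s := fun h => (hx x h).false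
  refine List.Perm.eq_of_pairwise' ((insert x s).pairwise_sort (· ≤ ·)) ?_ ?_
  · rw [List.pairwise_append]
    refine ⟨s.pairwise_sort _, List.pairwise_singleton _ _, fun a ha b hb => ?_⟩
    rw [List.mem_singleton.mp hb]
    exact (hx a ((Finset.mem_sort _).mp ha)).le
  · refine ((insert x s).sort_perm_toList _).trans ((Finset.toList_insert hxs).trans ?_)
    refine List.Perm.trans ?_ (List.perm_append_singleton x _).symm
    exact (s.sort_perm_toList _).symm.cons x

theorem consecDiffProd_empty : consecDiffProd ∅ = 1 := by
  simp [consecDiffProd]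

theorem consecDiffProd_singleton (x : ℕ) : consecDiffProd {x} = 1 := by
  simp [consecDiffProd]

theorem consecDiffProd_insert {s : Finset ℕ} {y x : ℕ} (hy : y ∈ s) (hmax : ∀ i ∈ s, i ≤ y)
    (hx : y < x) : consecDiffProd (insert x s) = consecDiffProd s * (x - y) := by
  have key : ∀ l : List ℕ, (((l ++ [y] ++ [x]).zip (l ++ [y] ++ [x]).tail).map
      fun p => p.2 - p.1).prod =
      (((l ++ [y]).zip (l ++ [y]).tail).map fun p => p.2 - p.1).prod * (x - y) := by
    intro l
    induction l with
    | nil => simp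
    | cons a l ih =>
      cases l with
      | nil => simp
      | cons b l =>
        simp only [List.cons_append, List.tail_cons, List.zip_cons_cons, List.map_cons,
          List.prod_cons] at ih ⊢
        rw [ih, mul_assoc]
  have hs : s.sort (· ≤ ·) = (s.erase y).sort (· ≤ ·) ++ [y] := by
    rw [← Finset.sort_insert_of_forall_lt, Finset.insert_erase hy]
    intro i hi
    exact lt_of_le_of_ne (hmax i (Finset.mem_of_mem_erase hi)) (Finset.ne_of_mem_erase hi)
  rw [consecDiffProd, consecDiffProd,
    Finset.sort_insert_of_forall_lt fun i hi => (hmax i hi).trans_lt hx, hs, key]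

/-- The variant of `LsumNat` in which the index `k + 1` is added to all index sets. -/
def TsumNat (k : ℕ) (a : ℕ → ℕ) : ℕ :=
  ∑ s ∈ (Finset.Icc 1 k).powerset, consecDiffProd (insert (k + 1) s) * ∏ i ∈ s, a i

theorem sum_powerset_Icc_succ (k : ℕ) (f : Finset ℕ → ℕ) :
    ∑ s ∈ (Finset.Icc 1 (k + 1)).powerset, f s =
      ∑ s ∈ (Finset.Icc 1 k).powerset, f s +
        ∑ s ∈ (Finset.Icc 1 k).powerset, f (insert (k + 1) s) := by
  rw [← Finset.insert_Icc_right_eq_Icc_add_one (by omega), Finset.sum_powerset_insert (by simp)]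

theorem LsumNat_eq (k : ℕ) (a : ℕ → ℕ) :
    LsumNat k a + 1 = ∑ s ∈ (Finset.Icc 1 k).powerset, consecDiffProd s * ∏ i ∈ s, a i := by
  rw [← Finset.sum_filter_add_sum_filter_not _ (fun s : Finset ℕ => s.Nonempty), LsumNat]
  congr 1
  rw [Finset.sum_eq_single_of_mem ∅ (by simp)]
  · simp [consecDiffProd_empty]
  · intro s hs hne
    exact absurd (Finset.nonempty_iff_ne_empty.mpr hne) (Finset.mem_filter.mp hs).2

theorem prod_insert_succ {k : ℕ} {s : Finset ℕ} (hs : s ∈ (Finset.Icc 1 k).powerset)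
    (a : ℕ → ℕ) : ∏ i ∈ insert (k + 1) s, a i = a (k + 1) * ∏ i ∈ s, a i :=
  Finset.prod_insert fun h => by
    have := Finset.mem_Icc.mp (Finset.mem_powerset.mp hs h)
    omega

theorem LsumNat_zero (a : ℕ → ℕ) : LsumNat 0 a = 0 := by
  have := LsumNat_eq 0 a
  simpa [consecDiffProd_empty] using this

theorem TsumNat_zero (a : ℕ → ℕ) : TsumNat 0 a = 1 := by
  simp [TsumNat, consecDiffProd_singleton]

theorem LsumNat_succ (k : ℕ) (a : ℕ → ℕ) :
    LsumNat (k + 1) a = LsumNat k a + a (k + 1) * TsumNat k a := by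
  have h := LsumNat_eq (k + 1) a
  rw [sum_powerset_Icc_succ, ← LsumNat_eq k a] at h
  have : ∑ s ∈ (Finset.Icc 1 k).powerset,
      consecDiffProd (insert (k + 1) s) * ∏ i ∈ insert (k + 1) s, a i =
      a (k + 1) * TsumNat k a := by
    rw [TsumNat, Finset.mul_sum]
    refine Finset.sum_congr rfl fun s hs => ?_
    rw [prod_insert_succ hs]
    ring
  omega

theorem consecDiffProd_insert_add_two {k : ℕ} {s : Finset ℕ}
    (hs : s ∈ (Finset.Icc 1 k).powerset) :
    consecDiffProd (insert (k + 2) s) + (if s = ∅ then 1 else 0) =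
      consecDiffProd (insert (k + 1) s) + consecDiffProd s := by
  rcases s.eq_empty_or_nonempty with rfl | hne
  · simp [consecDiffProd_empty, consecDiffProd_singleton]
  · have hlt := Finset.mem_Icc.mp (Finset.mem_powerset.mp hs (s.max'_mem hne))
    rw [consecDiffProd_insert (s.max'_mem hne) (fun i => s.le_max' i) (by omega : _ < k + 2),
      consecDiffProd_insert (s.max'_mem hne) (fun i => s.le_max' i) (by omega : _ < k + 1),
      if_neg hne.ne_empty, add_zero, ← mul_add_one]
    congr 1
    omega

theorem consecDiffProd_insert_insert {k : ℕ} {s : Finset ℕ}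
    (hs : s ∈ (Finset.Icc 1 k).powerset) :
    consecDiffProd (insert (k + 2) (insert (k + 1) s)) = consecDiffProd (insert (k + 1) s) := by
  rw [consecDiffProd_insert (Finset.mem_insert_self _ s) _ (Nat.lt_succ_self (k + 1))]
  · simp
  · intro i hi
    rcases Finset.mem_insert.mp hi with rfl | hi
    · exact le_rfl
    · have := Finset.mem_Icc.mp (Finset.mem_powerset.mp hs hi)
      omega

theorem TsumNat_succ (k : ℕ) (a : ℕ → ℕ) :
    TsumNat (k + 1) a = TsumNat k a + LsumNat (k + 1) a := by
  have h1 : ∑ s ∈ (Finset.Icc 1 k).powerset,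
      consecDiffProd (insert (k + 1 + 1) s) * ∏ i ∈ s, a i + 1 = TsumNat k a + (LsumNat k a + 1) := by
    rw [LsumNat_eq, TsumNat, ← Finset.sum_add_distrib]
    have h0 : ∑ s ∈ (Finset.Icc 1 k).powerset, (if s = ∅ then 1 else 0) * ∏ i ∈ s, a i = 1 := by
      rw [Finset.sum_eq_single_of_mem ∅ (by simp)]
      · simp
      · intro s _ hne
        rw [if_neg hne, zero_mul]
    refine (congrArg (_ + ·) h0.symm).trans ?_
    rw [← Finset.sum_add_distrib]
    refine Finset.sum_congr rfl fun s hs => ?_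
    rw [← add_mul, ← add_mul, consecDiffProd_insert_add_two hs]
  have h2 : ∑ s ∈ (Finset.Icc 1 k).powerset,
      consecDiffProd (insert (k + 1 + 1) (insert (k + 1) s)) * ∏ i ∈ insert (k + 1) s, a i =
      a (k + 1) * TsumNat k a := by
    rw [TsumNat, Finset.mul_sum]
    refine Finset.sum_congr rfl fun s hs => ?_
    rw [prod_insert_succ hs, consecDiffProd_insert_insert hs]
    ring
  rw [LsumNat_succ, TsumNat, sum_powerset_Icc_succ, h2]
  omega

/-- The words `w 1, …, w k` that encode the matchings without distinguished edge: `w i` is the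
edge used at the `i`-th vertex, `0` and `1` stand for the path edges to the right and to the left
and `2` for the distinguished leg. -/
def words (m : ℕ → ℕ) (k : ℕ) : Set (ℕ → ℕ) :=
  {w | w 0 = 0 ∧ (∀ i, k < i → w i = 0) ∧
    ∀ i < k, w (i + 1) < m (i + 1) + 2 ∧ w (i + 1) ≠ 2 ∧ (w i = 0 → w (i + 1) ≠ 1)}

/-- The words whose last letter is not `0`. -/
def properWords (m : ℕ → ℕ) (k : ℕ) : Set (ℕ → ℕ) :=
  {w | w ∈ words m k ∧ w k ≠ 0}

theorem words_succ (m : ℕ → ℕ) (k : ℕ) :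
    words m (k + 1) = words m k ∪ properWords m (k + 1) := by
  ext w
  constructor
  · intro hw
    by_cases h : w (k + 1) = 0
    · refine Or.inl ⟨hw.1, fun i hi => ?_, fun i hi => hw.2.2 i (by omega)⟩
      rcases Nat.lt_or_ge (k + 1) i with h' | h'
      · exact hw.2.1 i h'
      · rwa [show i = k + 1 by omega]
    · exact Or.inr ⟨hw, h⟩
  · rintro (hw | hw)
    · refine ⟨hw.1, fun i hi => hw.2.1 i (by omega), fun i hi => ?_⟩
      rcases Nat.lt_or_ge i k with h | h
      · exact hw.2.2 i h
      · have := hw.2.1 (i + 1) (by omega)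
        omega
    · exact hw.1

theorem update_mem_words {m : ℕ → ℕ} {k : ℕ} {w : ℕ → ℕ} (hw : w ∈ words m k) {c : ℕ}
    (hc : c < m (k + 1) + 2) (h2 : c ≠ 2) (h1 : w k = 0 → c ≠ 1) :
    Function.update w (k + 1) c ∈ words m (k + 1) := by
  have hne : ∀ i, i ≠ k + 1 → Function.update w (k + 1) c i = w i := fun i hi =>
    Function.update_of_ne hi _ _
  refine ⟨(hne 0 (by omega)).trans hw.1, fun i hi => (hne i (by omega)).trans
    (hw.2.1 i (by omega)), fun i hi => ?_⟩
  rw [hne i (by omega)]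
  rcases Nat.lt_or_ge i k with h | h
  · rw [hne (i + 1) (by omega)]
    exact hw.2.2 i h
  · obtain rfl : i = k := by omega
    rw [Function.update_self]
    exact ⟨hc, h2, h1⟩

theorem properWords_succ (m : ℕ → ℕ) (k : ℕ) :
    properWords m (k + 1) = (fun w => Function.update w (k + 1) 1) '' properWords m k ∪
      (fun p : (ℕ → ℕ) × ℕ => Function.update p.1 (k + 1) p.2) ''
        (words m k ×ˢ Set.Ico 3 (m (k + 1) + 2)) := by
  ext w
  constructor
  · rintro ⟨hw, h0⟩
    have hback : Function.update (Function.update w (k + 1) 0) (k + 1) (w (k + 1)) = w := by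
      simp
    have hne : ∀ i, i ≠ k + 1 → Function.update w (k + 1) 0 i = w i := fun i hi =>
      Function.update_of_ne hi _ _
    have hmem : Function.update w (k + 1) 0 ∈ words m k := by
      refine ⟨(hne 0 (by omega)).trans hw.1, fun i hi => ?_, fun i hi => ?_⟩
      · by_cases h : i = k + 1
        · rw [h, Function.update_self]
        · exact (hne i h).trans (hw.2.1 i (by omega))
      · rw [hne i (by omega), hne (i + 1) (by omega)]
        exact hw.2.2 i (by omega)
    have hlast := hw.2.2 k (Nat.lt_succ_self k)
    by_cases h1 : w (k + 1) = 1
    · refine Or.inl ⟨_, ⟨hmem, ?_⟩, by simpa only [h1] using hback⟩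
      rw [hne k (by omega)]
      exact fun h => hlast.2.2 h h1
    · exact Or.inr ⟨(_, w (k + 1)), ⟨hmem, by simp only [Set.mem_Ico]; omega⟩, hback⟩
  · rintro (⟨w, hw, rfl⟩ | ⟨⟨w, c⟩, ⟨hw, hc⟩, rfl⟩)
    · exact ⟨update_mem_words hw.1 (by omega) (by omega) fun h => absurd h hw.2, by simp⟩
    · simp only [Set.mem_Ico] at hc
      exact ⟨update_mem_words hw (by omega) (by omega) fun _ => by omega, by simp; omega⟩

theorem update_injOn_words (m : ℕ → ℕ) (k : ℕ) :
    Set.InjOn (fun p : (ℕ → ℕ) × ℕ => Function.update p.1 (k + 1) p.2)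
      (words m k ×ˢ Set.univ) := by
  rintro ⟨w, c⟩ ⟨hw, -⟩ ⟨w', c'⟩ ⟨hw', -⟩ h
  have hi := fun i => congrFun h i
  have hc : c = c' := by simpa using hi (k + 1)
  refine Prod.ext (funext fun i => ?_) hc
  by_cases hik : i = k + 1
  · exact (hw.2.1 i (by omega)).trans (hw'.2.1 i (by omega)).symm
  · simpa [Function.update_of_ne hik] using hi i

theorem card_words (m : ℕ → ℕ) (k : ℕ) :
    (words m k).Finite ∧ (words m k).ncard = TsumNat k (fun i => m i - 1) ∧
      (properWords m k).ncard = LsumNat k (fun i => m i - 1) := by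
  induction k with
  | zero =>
    have h0 : words m 0 = {0} := by
      ext w
      constructor
      · intro hw
        funext i
        rcases Nat.eq_zero_or_pos i with rfl | h
        · exact hw.1
        · exact hw.2.1 i h
      · rintro rfl
        exact ⟨rfl, fun _ _ => rfl, fun i hi => absurd hi (Nat.not_lt_zero i)⟩
    have h1 : properWords m 0 = ∅ := Set.eq_empty_of_forall_notMem fun w hw => hw.2 hw.1.1
    rw [h0, h1, TsumNat_zero, LsumNat_zero]
    simp
  | succ k ih =>
    obtain ⟨hfin, hT, hL⟩ := ih
    have hfin' : (properWords m k).Finite := hfin.subset fun w hw => hw.1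
    have hinj : Set.InjOn (fun w : ℕ → ℕ => Function.update w (k + 1) 1) (properWords m k) :=
      fun w hw w' hw' h => congrArg Prod.fst
        (update_injOn_words m k (x₁ := (w, 1)) (x₂ := (w', 1)) ⟨hw.1, trivial⟩ ⟨hw'.1, trivial⟩ h)
    have hfinP : (words m k ×ˢ Set.Ico 3 (m (k + 1) + 2)).Finite :=
      hfin.prod (Set.finite_Ico _ _)
    have hP : (properWords m (k + 1)).ncard = LsumNat (k + 1) (fun i => m i - 1) := by
      rw [properWords_succ, Set.ncard_union_eq _ (hfin'.image _) (hfinP.image _),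
        hinj.ncard_image,
        ((update_injOn_words m k).mono (Set.prod_mono_right (Set.subset_univ _))).ncard_image, Set.ncard_prod, hL, hT,
        LsumNat_succ, Set.ncard_eq_toFinset_card', Set.toFinset_Ico, Nat.card_Ico, mul_comm]
      · rfl
      · rw [Set.disjoint_left]
        rintro _ ⟨w, -, rfl⟩ ⟨⟨w', c⟩, ⟨-, hc⟩, h⟩
        have := congrFun h (k + 1)
        simp only [Function.update_self, Set.mem_Ico] at this hc
        omega
    have hfinP' : (properWords m (k + 1)).Finite := by
      rw [properWords_succ]
      exact (hfin'.image _).union (hfinP.image _)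
    rw [words_succ]
    refine ⟨hfin.union hfinP', ?_, hP⟩
    rw [Set.ncard_union_eq _ hfin hfinP', hT, hP, TsumNat_succ]
    exact Set.disjoint_left.mpr fun w hw hw' => hw'.2 (hw.2.1 _ (Nat.lt_succ_self k))

/-- The codes `(i, c)` of the edges of the caterpillar: the vertex `2 * i` of the path is incident
to the path edges `(i, 0)` to the right and `(i, 1)` to the left and to the legs `(i, x + 2)`. -/
def edgeCodes (m : ℕ → ℕ) (n : ℕ) : Set (ℕ × ℕ) :=
  {p | p.1 ≤ n ∧ p.2 < m (p.1 + 1) + 2 ∧ (p.2 = 1 → p.1 ≠ 0) ∧ (p.2 = 0 → p.1 ≠ n)}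

/-- The incidence relation on codes of edges. -/
def CodeIncident (p q : ℕ × ℕ) : Prop :=
  p.1 = q.1 ∨ (p.2 = 0 ∧ q.2 = 1 ∧ q.1 = p.1 + 1) ∨ (p.2 = 1 ∧ q.2 = 0 ∧ p.1 = q.1 + 1)

/-- A complex `K` with vertex set `E` whose vertices are coded by `edgeCodes m n`, in such a way
that the faces are the sets of vertices with pairwise non-incident codes. -/
structure IsEdgeCoding {α : Type*} (K : Set (Finset α)) (E : Set α) (m : ℕ → ℕ) (n : ℕ)
    (code : α → ℕ × ℕ) : Prop where
  bijOn : Set.BijOn code E (edgeCodes m n)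
  fst_le : ∀ a, (code a).1 ≤ n
  mem_iff : ∀ s, s ∈ K ↔ (s : Set α) ⊆ E ∧
    (s : Set α).Pairwise fun e f => ¬ CodeIncident (code e) (code f)

namespace IsEdgeCoding

variable {α : Type*} {K : Set (Finset α)} {E : Set α} {m : ℕ → ℕ} {n : ℕ} {code : α → ℕ × ℕ}

/-- The colour of an edge is the even vertex of the path it is incident to. -/
def col (h : IsEdgeCoding K E m n code) (a : α) : Fin (n + 1) :=
  ⟨(code a).1, Nat.lt_succ_of_le (h.fst_le a)⟩

theorem col_eq_iff (h : IsEdgeCoding K E m n code) {a : α} {i : Fin (n + 1)} :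
    h.col a = i ↔ (code a).1 = i :=
  Fin.ext_iff

theorem exists_code_eq_two (h : IsEdgeCoding K E m n code)
    (hm : ∀ i, 1 ≤ i → i ≤ n + 1 → 1 ≤ m i) (i : Fin (n + 1)) :
    ∃ a ∈ E, code a = ((i : ℕ), 2) := by
  refine h.bijOn.surjOn ⟨Nat.le_of_lt_succ i.2, ?_, by simp, by simp⟩
  have := hm (i + 1) (by omega) (by omega)
  show 2 < m (i + 1) + 2
  omega

theorem isRainbow [DecidableEq α] (h : IsEdgeCoding K E m n code) {z : Fin (n + 1) → α}
    (hz : ∀ i, z i ∈ E ∧ code (z i) = ((i : ℕ), 2)) : IsRainbow K h.col z where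
  empty_mem := (h.mem_iff ∅).mpr (by simp)
  down s hs t hts := by
    rw [h.mem_iff] at hs ⊢
    exact ⟨(Finset.coe_subset.mpr hts).trans hs.1, hs.2.mono (Finset.coe_subset.mpr hts)⟩
  injOn s hs a ha b hb hab := by
    by_contra hne
    exact ((h.mem_iff s).mp hs).2 ha hb hne (Or.inl (Fin.ext_iff.mp hab))
  col_z i := by rw [h.col_eq_iff, (hz i).2]
  cone s hs i hi := by
    rw [h.mem_iff] at hs ⊢
    rw [Finset.coe_insert, Set.pairwise_insert]
    refine ⟨Set.insert_subset (hz i).1 hs.1, hs.2, fun a ha _ => ?_⟩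
    have := mt h.col_eq_iff.mpr (hi a ha)
    simp only [CodeIncident, (hz i).2]
    omega

/-- The edges selected by a word. -/
noncomputable def wordFace [Fintype α] (E : Set α) (code : α → ℕ × ℕ) (w : ℕ → ℕ) : Finset α := by
  classical exact {a | a ∈ E ∧ (code a).2 = w ((code a).1 + 1)}

theorem mem_wordFace [Fintype α] {w : ℕ → ℕ} {a : α} :
    a ∈ wordFace E code w ↔ a ∈ E ∧ (code a).2 = w ((code a).1 + 1) := by
  simp [wordFace]

theorem exists_mem_wordFace [Fintype α] (h : IsEdgeCoding K E m n code) {w : ℕ → ℕ}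
    (hw : w ∈ properWords m (n + 1)) {i : ℕ} (hi : i ≤ n) :
    ∃ a ∈ wordFace E code w, code a = (i, w (i + 1)) := by
  obtain ⟨⟨hw0, -, hw⟩, hlast⟩ := hw
  have hwi := hw i (by omega)
  have hmem : (i, w (i + 1)) ∈ edgeCodes m n := by
    refine ⟨hi, hwi.1, fun h1 h0 => ?_, fun h0 h1 => ?_⟩
    · dsimp only at h0 h1
      subst h0
      exact hwi.2.2 hw0 h1
    · dsimp only at h0 h1
      subst h1
      exact hlast h0
  obtain ⟨a, ha, hcode⟩ := h.bijOn.surjOn hmem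
  exact ⟨a, mem_wordFace.mpr ⟨ha, by rw [hcode]⟩, hcode⟩

theorem bijOn_wordFace [Fintype α] (h : IsEdgeCoding K E m n code) {z : Fin (n + 1) → α}
    (hz : ∀ i, z i ∈ E ∧ code (z i) = ((i : ℕ), 2)) :
    Set.BijOn (wordFace E code) (properWords m (n + 1)) (IsRainbow.Facets K z) := by
  classical
  refine ⟨fun w hw => ?_, fun w hw w' hw' heq => ?_, fun s hs => ?_⟩
  · have hK : wordFace E code w ∈ K := by
      refine (h.mem_iff _).mpr ⟨fun a ha => (mem_wordFace.mp ha).1, fun a ha b hb hne hab => ?_⟩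
      obtain ⟨haE, ha⟩ := mem_wordFace.mp ha
      obtain ⟨hbE, hb⟩ := mem_wordFace.mp hb
      have key : ∀ a b, (code a).2 = w ((code a).1 + 1) → (code b).2 = w ((code b).1 + 1) →
          (code a).2 = 0 → (code b).2 = 1 → (code b).1 = (code a).1 + 1 → False := by
        intro a b ha hb ha0 hb1 hab
        have hle := h.fst_le b
        have := (hw.1.2.2 (code b).1 (by omega)).2.2
        rw [← hb, hab, ← ha] at this
        exact this ha0 hb1
      rcases hab with hab | ⟨ha0, hb1, hab⟩ | ⟨ha1, hb0, hab⟩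
      · exact hne (h.bijOn.injOn haE hbE (Prod.ext hab (by rw [ha, hb, hab])))
      · exact key a b ha hb ha0 hb1 hab
      · exact key b a hb ha hb0 ha1 hab
    refine ⟨hK, ?_, fun i hi => ?_⟩
    · rw [← Finset.card_image_of_injOn ((h.isRainbow hz).injOn _ hK)]
      refine ((Finset.card_eq_iff_eq_univ _).mpr (Finset.eq_univ_iff_forall.mpr fun i => ?_)).trans
        (Fintype.card_fin _)
      obtain ⟨a, ha, hcode⟩ := h.exists_mem_wordFace hw (Nat.le_of_lt_succ i.2)
      exact Finset.mem_image.mpr ⟨a, ha, h.col_eq_iff.mpr (by rw [hcode])⟩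
    · have h2 := (mem_wordFace.mp hi).2
      rw [(hz i).2] at h2
      exact (hw.1.2.2 i i.2).2.1 h2.symm
  · funext j
    rcases j with _ | i
    · rw [hw.1.1, hw'.1.1]
    · rcases Nat.lt_or_ge n i with hi | hi
      · rw [hw.1.2.1 _ (by omega), hw'.1.2.1 _ (by omega)]
      · obtain ⟨a, ha, hcode⟩ := h.exists_mem_wordFace hw hi
        rw [heq] at ha
        simpa [hcode] using (mem_wordFace.mp ha).2
  · have hR := h.isRainbow hz
    obtain ⟨hsE, hsp⟩ := (h.mem_iff s).mp hs.1
    choose e hes hecol using hR.exists_mem_col_eq hs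
    let w : ℕ → ℕ := fun j => if hj : 1 ≤ j ∧ j - 1 < n + 1 then (code (e ⟨j - 1, hj.2⟩)).2 else 0
    have hw : ∀ i (hi : i < n + 1), code (e ⟨i, hi⟩) = (i, w (i + 1)) := by
      intro i hi
      refine Prod.ext (h.col_eq_iff.mp (hecol ⟨i, hi⟩)) ?_
      simp only [w]
      rw [dif_pos ⟨by omega, hi⟩]
      rfl
    have hadm : ∀ i, i < n + 1 → (i, w (i + 1)) ∈ edgeCodes m n := fun i hi =>
      hw i hi ▸ h.bijOn.mapsTo (hsE (hes ⟨i, hi⟩))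
    refine ⟨w, ⟨⟨?_, fun i hi => ?_, fun i hi => ⟨(hadm i hi).2.1, fun h2 => ?_, fun h0 h1 => ?_⟩⟩,
      fun h0 => ?_⟩, ?_⟩
    · exact dif_neg (by omega)
    · exact dif_neg (by omega)
    · refine hs.2.2 ⟨i, hi⟩ ?_
      have : e ⟨i, hi⟩ = z ⟨i, hi⟩ :=
        h.bijOn.injOn (hsE (hes _)) (hz _).1 (by rw [hw, (hz _).2, h2])
      exact this ▸ hes _
    · rcases i with _ | i
      · exact (hadm 0 hi).2.2.1 h1 rfl
      · refine hsp (hes ⟨i, by omega⟩) (hes ⟨i + 1, hi⟩) (fun heq => ?_) ?_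
        · have := congrArg code heq
          rw [hw, hw] at this
          simp at this
        · rw [hw, hw]
          exact Or.inr (Or.inl ⟨h0, h1, rfl⟩)
    · exact (hadm n (Nat.lt_succ_self n)).2.2.2 h0 rfl
    · have hwc : ∀ a, code (e (h.col a)) = ((code a).1, w ((code a).1 + 1)) := fun a => hw _ _
      ext a
      rw [mem_wordFace]
      constructor
      · rintro ⟨haE, ha⟩
        have : a = e (h.col a) :=
          h.bijOn.injOn haE (hsE (hes _)) (by rw [hwc, ← ha])
        exact this ▸ hes _
      · intro ha
        have : e (h.col a) = a := hR.injOn s hs.1 (hes _) ha (hecol _)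
        refine ⟨hsE ha, ?_⟩
        have hwa := congrArg Prod.snd (hwc a)
        rwa [this] at hwa

theorem nonempty_homotopyEquiv [Fintype α] (h : IsEdgeCoding K E m n code)
    (hm : ∀ i, 1 ≤ i → i ≤ n + 1 → 1 ≤ m i) :
    Nonempty (ContinuousMap.HomotopyEquiv (Realization K)
      (WedgeOfSpheres (fun _ : Fin (LsumNat (n + 1) (fun i => m i - 1)) => n))) := by
  classical
  choose z hz using h.exists_code_eq_two hm
  have hcard : Nat.card (IsRainbow.Facets K z) = LsumNat (n + 1) (fun i => m i - 1) := by
    rw [← (card_words m (n + 1)).2.2, ← Nat.card_coe_set_eq]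
    exact (Nat.card_congr (h.bijOn_wordFace hz).equiv).symm
  exact (h.isRainbow hz).nonempty_homotopyEquiv (Finite.equivFinOfCardEq hcard).symm

end IsEdgeCoding

/-- The number of legs at the vertices of an alternating caterpillar. -/
abbrev altLegs (m : ℕ → ℕ) (n : ℕ) (j : Fin (2 * (n + 1) - 1)) : ℕ :=
  if (j : ℕ) % 2 = 0 then m ((j : ℕ) / 2 + 1) else 0

namespace altLegs

variable {m : ℕ → ℕ} {n : ℕ}

theorem eq_of_even {j : Fin (2 * (n + 1) - 1)} (hj : (j : ℕ) % 2 = 0) :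
    altLegs m n j = m ((j : ℕ) / 2 + 1) :=
  if_pos hj

theorem eq_zero_of_odd {j : Fin (2 * (n + 1) - 1)} (hj : ¬ (j : ℕ) % 2 = 0) :
    altLegs m n j = 0 :=
  if_neg hj

/-- The numbering of the vertices of a caterpillar by pairs of natural numbers. -/
def num : (Fin (2 * (n + 1) - 1) ⊕ Σ j, Fin (altLegs m n j)) → ℕ × ℕ
  | Sum.inl j => (j, 0)
  | Sum.inr p => (p.1, p.2 + 1)

theorem num_injective : Function.Injective (num (m := m) (n := n)) := by
  rintro (i | ⟨i, x⟩) (j | ⟨j, y⟩) h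
  · exact congrArg Sum.inl (Fin.ext (congrArg Prod.fst h))
  · exact absurd (congrArg Prod.snd h) (Nat.succ_ne_zero _).symm
  · exact absurd (congrArg Prod.snd h) (Nat.succ_ne_zero _)
  · obtain rfl : i = j := Fin.ext (congrArg Prod.fst h)
    obtain rfl : x = y := Fin.ext (Nat.succ_injective (congrArg Prod.snd h))
    rfl

/-- The endpoint of the edge with code `(i, c)` other than the even vertex `2 * i`. -/
def tip (p : ℕ × ℕ) : ℕ × ℕ :=
  if p.2 = 0 then (2 * p.1 + 1, 0) else if p.2 = 1 then (2 * p.1 - 1, 0) else (2 * p.1, p.2 - 1)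

/-- The numbers of the endpoints of the edge with a given code. -/
def edgeOfCode (p : ℕ × ℕ) : Sym2 (ℕ × ℕ) := s((2 * p.1, 0), tip p)

theorem edgeOfCode_injOn : Set.InjOn edgeOfCode (edgeCodes m n) := by
  rintro ⟨i, c⟩ ⟨-, -, h1, -⟩ ⟨j, d⟩ ⟨-, -, h2, -⟩ h
  simp only [edgeOfCode, tip, Sym2.eq_iff, Prod.ext_iff] at h h1 h2 ⊢
  split_ifs at h <;> simp only at h <;> omega

theorem edgeIncident_edgeOfCode {p q : ℕ × ℕ} (hp : p ∈ edgeCodes m n) (hq : q ∈ edgeCodes m n) :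
    EdgeIncident (edgeOfCode p) (edgeOfCode q) ↔ CodeIncident p q := by
  obtain ⟨i, c⟩ := p
  obtain ⟨j, d⟩ := q
  obtain ⟨-, -, h1, -⟩ := hp
  obtain ⟨-, -, h2, -⟩ := hq
  have : EdgeIncident (edgeOfCode (i, c)) (edgeOfCode (j, d)) ↔
      (2 * i, 0) = (2 * j, 0) ∨ (2 * i, 0) = tip (j, d) ∨ tip (i, c) = (2 * j, 0) ∨
        tip (i, c) = tip (j, d) := by
    simp only [EdgeIncident, edgeOfCode, Sym2.mem_iff, or_and_right, exists_or, exists_eq_left,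
      or_assoc]
  rw [this]
  simp only [CodeIncident, tip, Prod.ext_iff] at h1 h2 ⊢
  split_ifs <;> simp only [and_true] <;> omega

theorem edgeIncident_map {V W : Type*} {f : V → W} (hf : Function.Injective f) (a b : Sym2 V) :
    EdgeIncident (a.map f) (b.map f) ↔ EdgeIncident a b := by
  constructor
  · rintro ⟨v, ha, hb⟩
    obtain ⟨x, hx, rfl⟩ := Sym2.mem_map.mp ha
    obtain ⟨y, hy, hxy⟩ := Sym2.mem_map.mp hb
    exact ⟨x, hx, hf hxy ▸ hy⟩
  · rintro ⟨v, ha, hb⟩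
    exact ⟨f v, Sym2.mem_map.mpr ⟨v, ha, rfl⟩, Sym2.mem_map.mpr ⟨v, hb, rfl⟩⟩

theorem exists_code {e : Sym2 (Fin (2 * (n + 1) - 1) ⊕ Σ j, Fin (altLegs m n j))}
    (he : e ∈ (caterpillar (2 * (n + 1) - 1) (altLegs m n)).edgeSet) :
    ∃ p ∈ edgeCodes m n, edgeOfCode p = e.map num := by
  have key : ∀ i j : Fin (2 * (n + 1) - 1), (i : ℕ) + 1 = j →
      ∃ p ∈ edgeCodes m n, edgeOfCode p = s(((i : ℕ), 0), ((j : ℕ), 0)) := by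
    intro i j hij
    rcases Nat.even_or_odd' i with ⟨l, hl | hl⟩
    · refine ⟨(l, 0), ⟨?_, by simp, by simp, fun _ => ?_⟩, ?_⟩
      · show l ≤ n
        omega
      · show l ≠ n
        omega
      · rw [← hij, hl]
        rfl
    · refine ⟨(l + 1, 1), ⟨?_, by simp, by simp, by simp⟩, ?_⟩
      · show l + 1 ≤ n
        omega
      · rw [← hij, hl, Sym2.eq_swap]
        rfl
  have key' : ∀ (i : Fin (2 * (n + 1) - 1)) (x : Fin (altLegs m n i)),
      ∃ p ∈ edgeCodes m n, edgeOfCode p = s(((i : ℕ), 0), ((i : ℕ), (x : ℕ) + 1)) := by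
    intro i x
    by_cases hi : (i : ℕ) % 2 = 0
    · have hx := x.2.trans_eq (eq_of_even hi)
      refine ⟨((i : ℕ) / 2, x + 2), ⟨?_, ?_, by simp, by simp⟩, ?_⟩
      · show (i : ℕ) / 2 ≤ n
        omega
      · show (x : ℕ) + 2 < m ((i : ℕ) / 2 + 1) + 2
        omega
      · have : 2 * ((i : ℕ) / 2) = i := by omega
        simp [edgeOfCode, tip, this]
    · exact absurd (x.2.trans_eq (eq_zero_of_odd hi)) (Nat.not_lt_zero _)
  induction e with
  | _ p q =>
    obtain ⟨-, h⟩ := he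
    rw [Sym2.map_mk]
    rcases p with i | ⟨i, x⟩ <;> rcases q with j | ⟨j, y⟩
    · rcases h with h | h
      · exact key i j h
      · rw [Sym2.eq_swap]
        exact key j i h
    · obtain rfl : i = j := by simpa using h
      exact key' i y
    · obtain rfl : j = i := by simpa using h
      rw [Sym2.eq_swap]
      exact key' j x
    · simp at h

theorem exists_edge {p : ℕ × ℕ} (hp : p ∈ edgeCodes m n) :
    ∃ e ∈ (caterpillar (2 * (n + 1) - 1) (altLegs m n)).edgeSet, edgeOfCode p = e.map num := by
  obtain ⟨i, c⟩ := p
  obtain ⟨hi, hc, h1, h0⟩ := hp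
  dsimp only at hi hc h1 h0
  rcases c with _ | _ | x
  · have := h0 rfl
    refine ⟨s(Sum.inl ⟨2 * i, by omega⟩, Sum.inl ⟨2 * i + 1, by omega⟩), ⟨by simp, ?_⟩, rfl⟩
    exact Or.inl rfl
  · have := h1 rfl
    refine ⟨s(Sum.inl ⟨2 * i, by omega⟩, Sum.inl ⟨2 * i - 1, by omega⟩), ⟨?_, ?_⟩, rfl⟩
    · simp
      omega
    · refine Or.inr ?_
      show 2 * i - 1 + 1 = 2 * i
      omega
  · have hlt : x < altLegs m n ⟨2 * i, by omega⟩ := by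
      have h2 : 2 * i / 2 = i := by omega
      rw [eq_of_even (by simp)]
      simp only [h2]
      omega
    exact ⟨s(Sum.inl ⟨2 * i, by omega⟩, Sum.inr ⟨⟨2 * i, by omega⟩, ⟨x, hlt⟩⟩),
      ⟨by simp, Or.inl rfl⟩, rfl⟩

theorem exists_isEdgeCoding (m : ℕ → ℕ) (n : ℕ) :
    ∃ code, IsEdgeCoding (matchingComplex (caterpillar (2 * (n + 1) - 1) (altLegs m n)))
      (caterpillar (2 * (n + 1) - 1) (altLegs m n)).edgeSet m n code := by
  classical
  choose! f hf hfe using fun e he => exists_code (m := m) (n := n) (e := e) he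
  set E := (caterpillar (2 * (n + 1) - 1) (altLegs m n)).edgeSet
  have hcode : ∀ e ∈ E, (if e ∈ E then f e else (0, 0)) = f e := fun e he => if_pos he
  refine ⟨fun e => if e ∈ E then f e else (0, 0), ⟨fun e he => ?_, fun e he e' he' h => ?_,
    fun p hp => ?_⟩, fun e => ?_, fun s => ?_⟩
  · dsimp only
    rw [hcode e he]
    exact hf e he
  · dsimp only at h
    rw [hcode e he, hcode e' he'] at h
    exact Sym2.map.injective num_injective (by rw [← hfe e he, ← hfe e' he', h])
  · obtain ⟨e, he, hpe⟩ := exists_edge hp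
    refine ⟨e, he, (hcode e he).trans (edgeOfCode_injOn (hf e he) hp ?_)⟩
    rw [hfe e he, hpe]
  · split_ifs with he
    · exact (hf e he).1
    · exact Nat.zero_le n
  · refine and_congr_right fun hs => ?_
    refine forall₂_congr fun e he => forall₂_congr fun e' he' => forall_congr' fun _ => ?_
    dsimp only
    rw [hcode e (hs e he), hcode e' (hs e' he'),
      ← edgeIncident_edgeOfCode (hf e (hs e he)) (hf e' (hs e' he')), hfe e (hs e he),
      hfe e' (hs e' he'), edgeIncident_map num_injective]

end altLegs

/-- Let `G` be the caterpillar graph on a central path with `2k−1`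
vertices in which the `(2i−1)`-st path vertex carries `m i ≥ 1` legs (`i = 1, …, k`)
and the even path vertices carry no legs. With `a i = m i − 1`, the matching complex
`M(G)` is homotopy equivalent to a wedge of `L_k(a₁, …, a_k)` spheres of
dimension `k − 1`. -/
theorem matchingComplex_alternating_caterpillar (k : ℕ) (hk : 1 ≤ k) (m : ℕ → ℕ)
    (hm : ∀ i, 1 ≤ i → i ≤ k → 1 ≤ m i) :
    Nonempty
      (ContinuousMap.HomotopyEquiv
        (Realization (matchingComplex
          (caterpillar (2 * k - 1)
            (fun j : Fin (2 * k - 1) =>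
              if (j : ℕ) % 2 = 0 then m ((j : ℕ) / 2 + 1) else 0))))
        (WedgeOfSpheres
          (fun _ : Fin (LsumNat k (fun i => m i - 1)) => k - 1))) := by
  obtain ⟨n, rfl⟩ : ∃ n, k = n + 1 := ⟨k - 1, by omega⟩
  classical
  obtain ⟨code, h⟩ := altLegs.exists_isEdgeCoding m n
  exact h.nonempty_homotopyEquiv hm
end

section
/- Let T_h be the perfect binary tree of height h ≥ 3, i.e. the rooted tree in which every non-leaf vertex has exactly two children and every leaf has depth h. Let L = ⌈h/3⌉ − 1. Then the matching complex M(T_h) is at least ((Σ_{i=0}^{L} 2^{h−3i−1}) − 2)-connected. -/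
open SimpleGraph

/-- A space `X` is `n`-connected if it is nonempty and all homotopy groups
`π_ℓ` vanish for `ℓ ≤ n`. -/
def IsNConnectedSpace (n : ℕ) (X : Type*) [TopologicalSpace X] : Prop :=
  Nonempty X ∧ ∀ ℓ : ℕ, ℓ ≤ n → ∀ x : X, Subsingleton (HomotopyGroup (Fin ℓ) X x)

/-- The perfect binary tree of height `h`: vertices at depth `i` are indexed by
`Fin (2 ^ i)`, and the vertex `k` at depth `i + 1` is joined to its parent `k / 2`
at depth `i`. -/
def perfectBinaryTree (h : ℕ) :
    SimpleGraph (Σ i : Fin (h + 1), Fin (2 ^ (i : ℕ))) :=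
  SimpleGraph.fromRel fun a b =>
    (b.1 : ℕ) = (a.1 : ℕ) + 1 ∧ (b.2 : ℕ) / 2 = (a.2 : ℕ)

open scoped unitInterval Topology

/-- A map from the cube that is constant on the boundary of the cube. -/
def ConstOnBoundary {N X : Type*} [TopologicalSpace X] (f : C(I^N, X)) : Prop :=
  ∀ y ∈ Cube.boundary N, ∀ z ∈ Cube.boundary N, f y = f z

section Rebase

/-- The dilation of the unit interval about its midpoint by the factor `1 + s`, cut off at the
endpoints. -/
noncomputable def dilate (s t : I) : I :=
  Set.projIcc (0 : ℝ) 1 zero_le_one ((t : ℝ) + s * (t - 1 / 2))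

theorem continuous_dilate : Continuous fun p : I × I => dilate p.1 p.2 := by
  unfold dilate
  fun_prop

@[simp] theorem dilate_zero_left (t : I) : dilate 0 t = t := by
  simp [dilate]

@[simp] theorem dilate_zero_right (s : I) : dilate s 0 = 0 := by
  have := s.2.1
  simp only [dilate]
  rw [Set.projIcc_of_le_left]
  · rfl
  · simp only [Set.Icc.coe_zero]; linarith

@[simp] theorem dilate_one_right (s : I) : dilate s 1 = 1 := by
  have := s.2.1
  simp only [dilate]
  rw [Set.projIcc_of_right_le]
  · rfl
  · simp only [Set.Icc.coe_one]; linarith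

/-- A function on the cube that vanishes on the boundary and equals `1` on the central cube
`[1/4, 3/4]^N`. -/
noncomputable def collar {N : Type*} [Fintype N] (y : I^N) : I :=
  ∏ i, (Set.projIcc (0 : ℝ) 1 zero_le_one (4 * y i) *
    Set.projIcc (0 : ℝ) 1 zero_le_one (4 * (1 - y i)))

theorem continuous_collar {N : Type*} [Fintype N] : Continuous (collar (N := N)) := by
  unfold collar
  fun_prop

theorem collar_eq_zero {N : Type*} [Fintype N] {y : I^N} (hy : y ∈ Cube.boundary N) :
    collar y = 0 := by
  obtain ⟨i, hi⟩ := hy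
  refine Finset.prod_eq_zero (Finset.mem_univ i) ?_
  rcases hi with hi | hi <;> simp [hi]

theorem collar_eq_one {N : Type*} [Fintype N] {y : I^N}
    (hy : (fun i => dilate 1 (y i)) ∉ Cube.boundary N) : collar y = 1 := by
  refine Finset.prod_eq_one fun i _ => ?_
  have h : ¬ (dilate 1 (y i) = 0 ∨ dilate 1 (y i) = 1) := fun h => hy ⟨i, h⟩
  have h0 : 1 / 4 < (y i : ℝ) := by
    by_contra! h0
    refine h (.inl ?_)
    simp only [dilate]
    rw [Set.projIcc_of_le_left]
    · rfl
    · simp only [Set.Icc.coe_one]; linarith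
  have h1 : (y i : ℝ) < 3 / 4 := by
    by_contra! h1
    refine h (.inr ?_)
    simp only [dilate]
    rw [Set.projIcc_of_right_le]
    · rfl
    · simp only [Set.Icc.coe_one]; linarith
  rw [Set.projIcc_of_right_le _ (by linarith), Set.projIcc_of_right_le _ (by linarith)]
  exact mul_one _

theorem dilate_mem_boundary {N : Type*} {y : I^N} (hy : y ∈ Cube.boundary N) (s : I) :
    (fun i => dilate s (y i)) ∈ Cube.boundary N := by
  obtain ⟨i, hi⟩ := hy
  refine ⟨i, ?_⟩
  rcases hi with hi | hi <;> simp [hi]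

/-- A loop that is freely null-homotopic, through maps constant on the boundary of the cube, is
null-homotopic relative to the boundary. -/
theorem GenLoop.homotopic_const_of_homotopicWith {N X : Type*} [Fintype N] [TopologicalSpace X]
    {x : X} (f : GenLoop N X x)
    (h : ContinuousMap.HomotopicWith f.1 (ContinuousMap.const _ x) ConstOnBoundary) :
    GenLoop.Homotopic f GenLoop.const := by
  obtain ⟨H⟩ := h
  obtain ⟨γ, hγ0, hγ1, hγ⟩ : ∃ γ : C(I, X), γ 0 = x ∧ γ 1 = x ∧
      ∀ y ∈ Cube.boundary N, ∀ t, H (t, y) = γ t := by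
    by_cases hne : (Cube.boundary N).Nonempty
    · obtain ⟨z, hz⟩ := hne
      refine ⟨⟨fun t => H (t, z), by fun_prop⟩, ?_, ?_, fun y hy t => H.prop' t y hy z hz⟩
      · simpa using f.2 z hz
      · simp
    · exact ⟨.const _ x, rfl, rfl, fun y hy => (hne ⟨y, hy⟩).elim⟩
  have hd : Continuous fun p : I × (I^N) => fun i => dilate p.1 (p.2 i) :=
    continuous_pi fun i =>
      continuous_dilate.comp (by fun_prop : Continuous fun p : I × (I^N) => (p.1, p.2 i))
  have hd1 : Continuous fun y : I^N => fun i => dilate 1 (y i) :=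
    hd.comp (by fun_prop : Continuous fun y : I^N => ((1 : I), y))
  have hc := continuous_collar (N := N)
  let f₁ : C(I^N, X) := ⟨fun y => f.1 fun i => dilate 1 (y i), f.1.continuous.comp hd1⟩
  let f₂ : C(I^N, X) := ⟨fun y => γ (collar y), by fun_prop⟩
  have hend : ∀ y : I^N, H (collar y, fun i => dilate 1 (y i)) = γ (collar y) := by
    intro y
    by_cases hy : (fun i => dilate 1 (y i)) ∈ Cube.boundary N
    · exact hγ _ hy _
    · rw [collar_eq_one hy, H.apply_one, hγ1]; rfl
  have h₁ : f.1.HomotopicRel f₁ (Cube.boundary N) := by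
    refine ⟨⟨⟨⟨fun p => f.1 fun i => dilate p.1 (p.2 i), f.1.continuous.comp hd⟩, ?_, ?_⟩, ?_⟩⟩
    · intro y; simp
    · intro y; rfl
    · intro t y hy
      exact (f.2 _ (dilate_mem_boundary hy t)).trans (f.2 y hy).symm
  have h₂ : f₁.HomotopicRel f₂ (Cube.boundary N) := by
    refine ⟨⟨⟨⟨fun p => H (p.1 * collar p.2, fun i => dilate 1 (p.2 i)), ?_⟩, ?_, ?_⟩, ?_⟩⟩
    · exact H.continuous.comp ((continuous_fst.mul (hc.comp continuous_snd)).prodMk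
        (hd1.comp continuous_snd))
    · intro y; simp [f₁]
    · intro y; simp only [one_mul]; exact hend y
    · intro t y hy
      change H (t * collar y, fun i => dilate 1 (y i)) = f.1 fun i => dilate 1 (y i)
      rw [collar_eq_zero hy, mul_zero, H.apply_zero]
  have h₃ : f₂.HomotopicRel (GenLoop.const (N := N) (x := x)).1 (Cube.boundary N) := by
    refine ⟨⟨⟨⟨fun p => γ (σ p.1 * collar p.2), by fun_prop⟩, ?_, ?_⟩, ?_⟩⟩
    · intro y; simp [f₂]
    · intro y; simp [hγ0]
    · intro t y hy
      simp [f₂, collar_eq_zero hy]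
  exact (h₁.trans h₂).trans h₃

/-- If all maps from the cube that are constant on the boundary are freely homotopic to a fixed
constant map, then the homotopy group vanishes. -/
theorem subsingleton_homotopyGroup {N X : Type*} [Fintype N] [TopologicalSpace X] (c : X)
    (h : ∀ f : C(I^N, X), ConstOnBoundary f →
      ContinuousMap.HomotopicWith f (ContinuousMap.const _ c) ConstOnBoundary) (x : X) :
    Subsingleton (HomotopyGroup N X x) := by
  have key : ∀ f : GenLoop N X x, GenLoop.Homotopic f GenLoop.const := fun f =>
    GenLoop.homotopic_const_of_homotopicWith f <|
      (h f.1 fun y hy z hz => (f.2 y hy).trans (f.2 z hz).symm).trans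
        (h (ContinuousMap.const _ x) fun _ _ _ _ => rfl).symm
  refine ⟨fun a b => ?_⟩
  induction a using Quotient.inductionOn with | _ f
  induction b using Quotient.inductionOn with | _ g
  exact Quotient.sound ((key f).trans (key g).symm)

end Rebase

section Bricks

/-- A nonnegative continuous function on the line that is positive exactly on `(0, 1)`. -/
noncomputable def bump (t : ℝ) : ℝ := max 0 t * max 0 (1 - t)

theorem continuous_bump : Continuous bump := by
  unfold bump
  fun_prop

theorem bump_nonneg (t : ℝ) : 0 ≤ bump t :=
  mul_nonneg (le_max_left _ _) (le_max_left _ _)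

theorem bump_pos_iff {t : ℝ} : 0 < bump t ↔ 0 < t ∧ t < 1 := by
  unfold bump
  constructor
  · intro h
    constructor
    · by_contra! h0
      simp [max_eq_left h0] at h
    · by_contra! h0
      simp [max_eq_left (sub_nonpos.2 h0)] at h
  · rintro ⟨h0, h1⟩
    exact mul_pos (lt_max_of_lt_right h0) (lt_max_of_lt_right (sub_pos.2 h1))

theorem prod_bump_pos_iff {N : Type*} [Fintype N] {t : N → ℝ} :
    0 < ∏ i, bump (t i) ↔ ∀ i, 0 < t i ∧ t i < 1 := by
  simp only [← bump_pos_iff]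
  refine ⟨fun h i => (bump_nonneg _).lt_of_ne' fun h0 => ?_,
    fun h => Finset.prod_pos fun i _ => h i⟩
  rw [Finset.prod_eq_zero (Finset.mem_univ i) h0] at h
  exact h.false

/-- The `n`-dimensional cube is covered by the supports of finitely many nonnegative functions
that are arbitrarily small and that come in `n + 1` families, each consisting of functions with
pairwise disjoint supports. -/
theorem exists_brick_functions (n : ℕ) {ε : ℝ} (hε : 0 < ε) :
    ∃ (J : Type) (_ : Fintype J) (φ : Fin (n + 1) → J → (I^(Fin n)) → ℝ),
      (∀ c j, Continuous (φ c j)) ∧ (∀ c j y, 0 ≤ φ c j y) ∧ (∀ y, ∃ c j, 0 < φ c j y) ∧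
      (∀ c y j j', 0 < φ c j y → 0 < φ c j' y → j = j') ∧
      (∀ c j y y', 0 < φ c j y → 0 < φ c j y' → dist y y' < ε) := by
  obtain ⟨M, hM⟩ := exists_nat_gt (1 / ε)
  have hM0 : (0 : ℝ) < M := (one_div_pos.2 hε).trans hM
  have hMε : 1 < M * ε := (div_lt_iff₀ hε).1 hM
  have hn : (0 : ℝ) < n + 1 := by positivity
  refine ⟨Fin n → Fin (M + 2), inferInstance,
    fun c j y => ∏ i, bump (M * y i + 1 - (c : ℕ) / (n + 1) - (j i : ℕ)), ?_, ?_, ?_, ?_, ?_⟩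
  · intro c j
    exact continuous_finsetProd _ fun i _ => continuous_bump.comp (by fun_prop)
  · exact fun c j y => Finset.prod_nonneg fun i _ => bump_nonneg _
  · intro y
    simp only [prod_bump_pos_iff]
    have hc : ∃ c : Fin (n + 1), ∀ i, ∀ k : ℤ, (M * y i + 1 - (c : ℕ) / (n + 1) : ℝ) ≠ k := by
      by_contra! hcon
      choose i k hk using hcon
      obtain ⟨c, c', hne, hi⟩ := Fintype.exists_ne_map_eq_of_card_lt i (by simp)
      have e := hk c
      rw [hi] at e
      have e2 : ((c' : ℕ) : ℝ) - (c : ℕ) = ((k c - k c' : ℤ) : ℝ) * (n + 1) := by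
        rw [Int.cast_sub, ← e, ← hk c']
        field_simp
        ring
      have e3 : ((c' : ℕ) : ℤ) - (c : ℕ) = (k c - k c') * (n + 1) := by exact_mod_cast e2
      have l1 := c.2
      have l2 := c'.2
      have : k c - k c' = 0 := by
        rcases lt_trichotomy (k c - k c') 0 with h | h | h
        · nlinarith
        · exact h
        · nlinarith
      rw [this] at e3
      exact hne (Fin.ext (by omega))
    obtain ⟨c, hc⟩ := hc
    have hc1 : ((c : ℕ) : ℝ) / (n + 1) < 1 := by
      rw [div_lt_one hn]
      exact_mod_cast c.2
    have hc0 : 0 ≤ ((c : ℕ) : ℝ) / (n + 1) := by positivity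
    have hpos : ∀ i, 0 < (M * y i + 1 - (c : ℕ) / (n + 1) : ℝ) := fun i => by
      have := mul_nonneg hM0.le (y i).2.1
      linarith
    have hlt : ∀ i, ⌊(M * y i + 1 - (c : ℕ) / (n + 1) : ℝ)⌋₊ < M + 2 := fun i => by
      rw [Nat.floor_lt (hpos i).le]
      have := mul_le_mul_of_nonneg_left (y i).2.2 hM0.le
      push_cast
      linarith
    refine ⟨c, fun i => ⟨_, hlt i⟩, fun i => ⟨?_, ?_⟩⟩
    · have h1 := Nat.floor_le (hpos i).le
      have h2 := hc i (⌊(M * y i + 1 - (c : ℕ) / (n + 1) : ℝ)⌋₊ : ℕ)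
      exact sub_pos.2 (lt_of_le_of_ne h1 fun h => h2 (by exact_mod_cast h.symm))
    · have h1 := Nat.lt_floor_add_one (M * y i + 1 - (c : ℕ) / (n + 1) : ℝ)
      dsimp only
      linarith
  · intro c y j j' h h'
    rw [prod_bump_pos_iff] at h h'
    funext i
    have h1 := h i
    have h2 := h' i
    have h3 : ((j i : ℕ) : ℝ) < ((j' i : ℕ) : ℝ) + 1 := by linarith
    have h4 : ((j' i : ℕ) : ℝ) < ((j i : ℕ) : ℝ) + 1 := by linarith
    have h5 : (j i : ℕ) < (j' i : ℕ) + 1 := by exact_mod_cast h3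
    have h6 : (j' i : ℕ) < (j i : ℕ) + 1 := by exact_mod_cast h4
    exact Fin.ext (by omega)
  · intro c j y y' h h'
    rw [prod_bump_pos_iff] at h h'
    rw [dist_pi_lt_iff hε]
    intro i
    have h1 := h i
    have h2 := h' i
    rw [Subtype.dist_eq, Real.dist_eq, abs_lt]
    constructor <;> nlinarith

end Bricks

section FlagComplex

variable {α : Type*}

/-- The faces of the flag complex on the vertex set `A` whose non-edges are the pairs
related by `R`. -/
def flagComplex (A : Set α) (R : α → α → Prop) : Set (Finset α) :=
  {m | (∀ e ∈ m, e ∈ A) ∧ (m : Set α).Pairwise fun e f => ¬ R e f}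

variable [Fintype α] {A : Set α} {R : α → α → Prop}

/-- The nonzero nonnegative weights supported on a face of the flag complex. -/
structure IsFlagWeight (A : Set α) (R : α → α → Prop) (f : α → ℝ) : Prop where
  nonneg : ∀ a, 0 ≤ f a
  sum_pos : 0 < ∑ a, f a
  mem : ∀ a, f a ≠ 0 → a ∈ A
  pairwise : ∀ a b, f a ≠ 0 → f b ≠ 0 → a ≠ b → ¬ R a b

theorem Realization.sum_eq_one {K : Set (Finset α)} (p : Realization K) : ∑ a, p.1 a = 1 := by
  obtain ⟨s, -, hs, h1⟩ := p.2.2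
  refine (Finset.sum_subset (Finset.subset_univ s) fun a _ ha => ?_).symm.trans h1
  by_contra h
  exact ha (hs a h)

theorem Realization.exists_inv_card_le {K : Set (Finset α)} (p : Realization K) :
    ∃ a, 1 / (Fintype.card α : ℝ) ≤ p.1 a := by
  have hsum := p.sum_eq_one
  by_contra! h
  have hne : (Finset.univ : Finset α).Nonempty := by
    by_contra h0
    rw [Finset.not_nonempty_iff_eq_empty] at h0
    simp [h0] at hsum
  have hlt := Finset.sum_lt_sum_of_nonempty hne fun a _ => h a
  have hc : (Fintype.card α : ℝ) ≠ 0 := by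
    have := Finset.card_pos.2 hne
    rw [Finset.card_univ] at this
    positivity
  rw [hsum, Finset.sum_const, Finset.card_univ, nsmul_eq_mul, mul_one_div_cancel hc] at hlt
  exact hlt.false

theorem Realization.isFlagWeight (p : Realization (flagComplex A R)) : IsFlagWeight A R p.1 := by
  refine ⟨p.2.1, by rw [p.sum_eq_one]; exact one_pos, ?_, ?_⟩
  all_goals obtain ⟨s, hs, hps, -⟩ := p.2.2
  · exact fun a ha => hs.1 a (hps a ha)
  · exact fun a b ha hb hab => hs.2 (hps a ha) (hps b hb) hab

theorem Realization.eq_of_forall_ne_eq_zero {K : Set (Finset α)} {p q : Realization K} (v : α)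
    (hp : ∀ a, a ≠ v → p.1 a = 0) (hq : ∀ a, a ≠ v → q.1 a = 0) : p = q := by
  have hpv := p.sum_eq_one
  have hqv := q.sum_eq_one
  rw [Finset.sum_eq_single v (fun a _ h => hp a h) (by simp)] at hpv
  rw [Finset.sum_eq_single v (fun a _ h => hq a h) (by simp)] at hqv
  refine Subtype.ext (funext fun a => ?_)
  by_cases h : a = v
  · rw [h, hpv, hqv]
  · rw [hp a h, hq a h]

/-- The point of the realization obtained by rescaling a weight to total weight one. -/
noncomputable def IsFlagWeight.normalize {f : α → ℝ} (hf : IsFlagWeight A R f) :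
    Realization (flagComplex A R) :=
  ⟨fun a => f a / ∑ b, f b, fun a => div_nonneg (hf.nonneg a) hf.sum_pos.le, by
    classical
    refine ⟨Finset.univ.filter fun a => f a ≠ 0, ⟨?_, ?_⟩, ?_, ?_⟩
    · intro a ha
      exact hf.mem a (by simpa using ha)
    · intro a ha b hb hab
      exact hf.pairwise a b (by simpa using ha) (by simpa using hb) hab
    · intro a ha
      have : f a ≠ 0 := fun h => ha (by simp [h])
      simpa using this
    · rw [← Finset.sum_div, Finset.sum_filter_ne_zero]
      exact div_self hf.sum_pos.ne'⟩

theorem IsFlagWeight.normalize_apply {f : α → ℝ} (hf : IsFlagWeight A R f) (a : α) :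
    hf.normalize.1 a = f a / ∑ b, f b := rfl

theorem IsFlagWeight.normalize_ne_zero_iff {f : α → ℝ} (hf : IsFlagWeight A R f) {a : α} :
    hf.normalize.1 a ≠ 0 ↔ f a ≠ 0 := by
  rw [hf.normalize_apply, Ne, div_eq_zero_iff, not_or]
  exact ⟨fun h => h.1, fun h => ⟨h, hf.sum_pos.ne'⟩⟩

theorem IsFlagWeight.normalize_eq {f : α → ℝ} (hf : IsFlagWeight A R f)
    (p : Realization (flagComplex A R)) (h : f = p.1) : hf.normalize = p := by
  subst h
  refine Subtype.ext (funext fun a => ?_)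
  rw [hf.normalize_apply, p.sum_eq_one, div_one]

theorem IsFlagWeight.continuous_normalize {Z : Type*} [TopologicalSpace Z] {F : Z → α → ℝ}
    (hF : ∀ z, IsFlagWeight A R (F z)) (hc : ∀ a, Continuous fun z => F z a) :
    Continuous fun z => (hF z).normalize := by
  refine Continuous.subtype_mk (continuous_pi fun a => ?_) _
  exact (hc a).div (continuous_finsetSum _ fun b _ => hc b) fun z => (hF z).sum_pos.ne'

/-- The segment between two points stays in the realization, when their supports span a face. -/
theorem IsFlagWeight.segment {p q : Realization (flagComplex A R)}
    (hpq : ∀ a b, p.1 a ≠ 0 → q.1 b ≠ 0 → a ≠ b → ¬ R a b) (hR : ∀ a b, R a b → R b a) (t : I) :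
    IsFlagWeight A R fun a => (1 - (t : ℝ)) * p.1 a + t * q.1 a := by
  have hs : ∀ a, (1 - (t : ℝ)) * p.1 a + t * q.1 a ≠ 0 → p.1 a ≠ 0 ∨ q.1 a ≠ 0 := by
    intro a
    contrapose!
    rintro ⟨h, h'⟩
    simp [h, h']
  refine ⟨fun a => ?_, ?_, fun a ha => ?_, fun a b ha hb hab => ?_⟩
  · exact add_nonneg (mul_nonneg (sub_nonneg.2 t.2.2) (p.2.1 a)) (mul_nonneg t.2.1 (q.2.1 a))
  · rw [Finset.sum_add_distrib, ← Finset.mul_sum, ← Finset.mul_sum, p.sum_eq_one, q.sum_eq_one]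
    norm_num
  · exact (hs a ha).elim (p.isFlagWeight.mem a) (q.isFlagWeight.mem a)
  · rcases hs a ha with ha | ha <;> rcases hs b hb with hb | hb
    · exact p.isFlagWeight.pairwise a b ha hb hab
    · exact hpq a b ha hb hab
    · exact fun h => hpq b a hb ha hab.symm (hR a b h)
    · exact q.isFlagWeight.pairwise a b ha hb hab

/-- Maps that are pointwise joined by segments are homotopic. -/
theorem homotopicWith_of_segment {N : Type*} (hR : ∀ a b, R a b → R b a)
    {f g : C(I^N, Realization (flagComplex A R))} (hf : ConstOnBoundary f)
    (hg : ConstOnBoundary g)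
    (hfg : ∀ y a b, (f y).1 a ≠ 0 → (g y).1 b ≠ 0 → a ≠ b → ¬ R a b) :
    ContinuousMap.HomotopicWith f g ConstOnBoundary := by
  have hw : ∀ z : I × (I^N), IsFlagWeight A R
      fun a => (1 - (z.1 : ℝ)) * (f z.2).1 a + z.1 * (g z.2).1 a :=
    fun z => IsFlagWeight.segment (hfg z.2) hR z.1
  refine ⟨⟨⟨⟨fun z => (hw z).normalize, IsFlagWeight.continuous_normalize hw ?_⟩, ?_, ?_⟩, ?_⟩⟩
  · intro a
    have h₁ : Continuous fun z : I × (I^N) => (f z.2).1 a :=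
      (continuous_apply a).comp (continuous_subtype_val.comp (f.continuous.comp continuous_snd))
    have h₂ : Continuous fun z : I × (I^N) => (g z.2).1 a :=
      (continuous_apply a).comp (continuous_subtype_val.comp (g.continuous.comp continuous_snd))
    have h₃ : Continuous fun z : I × (I^N) => (z.1 : ℝ) :=
      continuous_subtype_val.comp continuous_fst
    exact ((continuous_const.sub h₃).mul h₁).add (h₃.mul h₂)
  · intro y
    exact (hw (0, y)).normalize_eq _ (by simp)
  · intro y
    exact (hw (1, y)).normalize_eq _ (by simp)
  · intro t y hy z hz
    refine Subtype.ext (funext fun a => ?_)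
    simp only [ContinuousMap.coe_mk, IsFlagWeight.normalize_apply, hf y hy z hz, hg y hy z hz]

/-- A map from the `n`-cube can be deformed so that the support of each of its values has at most
`n + 1` elements. -/
theorem exists_homotopicWith_small_support (hR : ∀ a b, R a b → R b a) (n : ℕ)
    (f : C(I^(Fin n), Realization (flagComplex A R))) (hf : ConstOnBoundary f) :
    ∃ g, ConstOnBoundary g ∧ ContinuousMap.HomotopicWith f g ConstOnBoundary ∧
      ∀ (ι : Type) [Fintype ι] (y) (w : ι → α), Function.Injective w →
        (∀ i, (g y).1 (w i) ≠ 0) → Fintype.card ι ≤ n + 1 := by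
  classical
  choose V hV using fun p : Realization (flagComplex A R) => p.exists_inv_card_le
  have hcard : 0 < 1 / (Fintype.card α : ℝ) := by
    have : Nonempty α := ⟨V (f 0)⟩
    have := Fintype.card_pos (α := α)
    positivity
  obtain ⟨ε, hε, hfε⟩ := Metric.uniformContinuous_iff.1
    (CompactSpace.uniformContinuous_of_continuous
      (continuous_subtype_val.comp f.continuous)) _ hcard
  obtain ⟨J, _, φ, hφc, hφ0, hφpos, hφinj, hφε⟩ := exists_brick_functions n hε
  have hr : ∀ c j, ∃ r, ((∃ y, 0 < φ c j y) → 0 < φ c j r) ∧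
      ((∃ y ∈ Cube.boundary (Fin n), 0 < φ c j y) → r ∈ Cube.boundary (Fin n)) := by
    intro c j
    by_cases h₁ : ∃ y ∈ Cube.boundary (Fin n), 0 < φ c j y
    · obtain ⟨r, hr, hr'⟩ := h₁
      exact ⟨r, fun _ => hr', fun _ => hr⟩
    · by_cases h₂ : ∃ y, 0 < φ c j y
      · obtain ⟨r, hr⟩ := h₂
        exact ⟨r, fun _ => hr, fun h => (h₁ h).elim⟩
      · exact ⟨0, fun h => (h₂ h).elim, fun h => (h₁ h).elim⟩
  choose r hr hr' using hr
  let v : Fin (n + 1) → J → α := fun c j => V (f (r c j))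
  have hv : ∀ c j y, 0 < φ c j y → (f y).1 (v c j) ≠ 0 := by
    intro c j y hy h0
    have h₁ := hfε (hφε c j _ _ (hr c j ⟨y, hy⟩) hy)
    have h₂ := (dist_le_pi_dist _ _ (v c j)).trans_lt h₁
    simp only [Function.comp_apply, h0, Real.dist_eq, sub_zero] at h₂
    exact ((le_abs_self _).trans_lt h₂).not_ge (hV (f (r c j)))
  let G : (I^(Fin n)) → α → ℝ := fun y a => ∑ c, ∑ j, if v c j = a then φ c j y else 0
  have hterm : ∀ y a c j, 0 ≤ if v c j = a then φ c j y else 0 := by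
    intro y a c j
    split_ifs
    exacts [hφ0 c j y, le_rfl]
  have hG0 : ∀ y a, 0 ≤ G y a := fun y a =>
    Finset.sum_nonneg fun c _ => Finset.sum_nonneg fun j _ => hterm y a c j
  have hGne : ∀ y a, G y a ≠ 0 → ∃ c j, v c j = a ∧ 0 < φ c j y := by
    intro y a h
    obtain ⟨c, -, hc⟩ := Finset.exists_ne_zero_of_sum_ne_zero h
    obtain ⟨j, -, hj⟩ := Finset.exists_ne_zero_of_sum_ne_zero hc
    by_cases hva : v c j = a
    · rw [if_pos hva] at hj
      exact ⟨c, j, hva, (hφ0 c j y).lt_of_ne' hj⟩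
    · exact (hj (if_neg hva)).elim
  have hGf : ∀ y a, G y a ≠ 0 → (f y).1 a ≠ 0 := by
    intro y a h
    obtain ⟨c, j, rfl, hj⟩ := hGne y a h
    exact hv c j y hj
  have hGw : ∀ y, IsFlagWeight A R (G y) := by
    refine fun y => ⟨hG0 y, ?_, fun a ha => (f y).isFlagWeight.mem a (hGf y a ha),
      fun a b ha hb => (f y).isFlagWeight.pairwise a b (hGf y a ha) (hGf y b hb)⟩
    obtain ⟨c, j, hj⟩ := hφpos y
    refine Finset.sum_pos' (fun a _ => hG0 y a) ⟨v c j, Finset.mem_univ _, ?_⟩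
    refine Finset.sum_pos' (fun c' _ => Finset.sum_nonneg fun j' _ => hterm y _ c' j')
      ⟨c, Finset.mem_univ _, ?_⟩
    refine Finset.sum_pos' (fun j' _ => hterm y _ c j') ⟨j, Finset.mem_univ _, ?_⟩
    rwa [if_pos rfl]
  let g : C(I^(Fin n), Realization (flagComplex A R)) :=
    ⟨fun y => (hGw y).normalize, IsFlagWeight.continuous_normalize hGw fun a =>
      continuous_finsetSum _ fun c _ => continuous_finsetSum _ fun j _ => by
        split_ifs
        exacts [hφc c j, continuous_const]⟩
  have hgG : ∀ y a, (g y).1 a ≠ 0 → G y a ≠ 0 := fun y a => (hGw y).normalize_ne_zero_iff.1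
  have hg : ConstOnBoundary g := by
    have hz : ∀ y ∈ Cube.boundary (Fin n), ∀ z ∈ Cube.boundary (Fin n), ∀ a, a ≠ V (f y) →
        (g z).1 a = 0 := by
      intro y hy z hz a
      contrapose!
      intro h
      obtain ⟨c, j, rfl, hj⟩ := hGne z a (hgG z a h)
      exact congrArg V (hf _ (hr' c j ⟨z, hz, hj⟩) y hy)
    exact fun y hy z hz' => Realization.eq_of_forall_ne_eq_zero (V (f y)) (hz y hy y hy)
      (hz y hy z hz')
  refine ⟨g, hg, homotopicWith_of_segment hR hf hg fun y a b ha hb =>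
    (f y).isFlagWeight.pairwise a b ha (hGf y b (hgG y b hb)), ?_⟩
  intro ι _ y w hw hwy
  choose c j hcw hcj using fun i => hGne y (w i) (hgG y (w i) (hwy i))
  have hc : Function.Injective c := by
    intro i i' h
    have hj : j i = j i' := hφinj (c i) y _ _ (hcj i) (by rw [h]; exact hcj i')
    exact hw (by rw [← hcw i, ← hcw i', h, hj])
  simpa using Fintype.card_le_of_injective c hc

open Classical in
/-- A deformation of weights: at time `t` all weights are truncated from below at `t`, and the
vertices `x i` all of whose non-neighbours have been deleted receive some weight. -/
noncomputable def sweep {ι : Type} [Fintype ι] (R : α → α → Prop) (x : ι → α) (t : ℝ)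
    (p : α → ℝ) (a : α) : ℝ :=
  max 0 (p a - t) + ∑ i, if x i = a then
    t * ∏ v, (if v ≠ x i ∧ R v (x i) then max 0 (t - p v) else 1) else 0

section Sweep

variable {ι : Type} [Fintype ι] {x : ι → α}

theorem sweep_ne_zero {p : α → ℝ} {t : ℝ} {a : α} (h : sweep R x t p a ≠ 0) :
    t < p a ∨ ∃ i, x i = a ∧ ∀ v, v ≠ a → R v a → p v < t := by
  classical
  by_contra! hcon
  obtain ⟨hpa, hx⟩ := hcon
  refine h ?_
  rw [sweep, max_eq_left (sub_nonpos.2 hpa), zero_add]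
  refine Finset.sum_eq_zero fun i _ => ?_
  split_ifs with hi
  · subst hi
    obtain ⟨v, hv, hvR, hvt⟩ := hx i rfl
    rw [Finset.prod_eq_zero (Finset.mem_univ v), mul_zero]
    rw [if_pos ⟨hv, hvR⟩, max_eq_left (sub_nonpos.2 hvt)]
  · rfl

theorem sweep_zero {p : α → ℝ} (hp : ∀ a, 0 ≤ p a) : sweep R x 0 p = p := by
  funext a
  simp [sweep, hp a]

theorem continuous_sweep (a : α) : Continuous fun z : ℝ × (α → ℝ) => sweep R x z.1 z.2 a := by
  classical
  unfold sweep
  refine Continuous.add (by fun_prop) (continuous_finsetSum _ fun i _ => ?_)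
  split_ifs
  · refine continuous_fst.mul (continuous_finsetProd _ fun v _ => ?_)
    split_ifs
    · fun_prop
    · fun_prop
  · fun_prop

theorem isFlagWeight_sweep (hR : ∀ a b, R a b → R b a) (hxA : ∀ i, x i ∈ A)
    (hxR : ∀ i, R (x i) (x i)) (hx : ∀ v ∈ A, ∀ i j, R v (x i) → R v (x j) → i = j)
    (p : Realization (flagComplex A R))
    (hp : ∀ w : ι → α, Function.Injective w → ¬ ∀ i, p.1 (w i) ≠ 0) (t : I) :
    IsFlagWeight A R (sweep R x t p.1) := by
  classical
  have ht := t.2.1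
  have hterm : ∀ a i, 0 ≤ if x i = a then
      (t : ℝ) * ∏ v, (if v ≠ x i ∧ R v (x i) then max 0 (t - p.1 v) else 1) else 0 := by
    intro a i
    split_ifs
    · refine mul_nonneg ht (Finset.prod_nonneg fun v _ => ?_)
      split_ifs
      exacts [le_max_left _ _, zero_le_one]
    · exact le_rfl
  have hnonneg : ∀ a, 0 ≤ sweep R x t p.1 a := fun a =>
    add_nonneg (le_max_left _ _) (Finset.sum_nonneg fun i _ => hterm a i)
  have hp_mem : ∀ a, (t : ℝ) < p.1 a → p.1 a ≠ 0 := fun a h => (ht.trans_lt h).ne'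
  refine ⟨hnonneg, ?_, fun a ha => ?_, fun a b ha hb hab hRab => ?_⟩
  · refine (Finset.sum_nonneg fun a _ => hnonneg a).lt_of_ne' fun h0 => ?_
    have hzero : ∀ a, sweep R x t p.1 a = 0 := fun a =>
      (Finset.sum_eq_zero_iff_of_nonneg fun a _ => hnonneg a).1 h0 a (Finset.mem_univ a)
    have hle : ∀ a, p.1 a ≤ t := by
      intro a
      by_contra! h
      have h₁ : 0 < sweep R x t p.1 a := add_pos_of_pos_of_nonneg
        (lt_max_of_lt_right (sub_pos.2 h)) (Finset.sum_nonneg fun i _ => hterm a i)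
      exact h₁.ne' (hzero a)
    have htpos : 0 < (t : ℝ) := by
      refine ht.lt_of_ne fun h => ?_
      have h₁ := p.sum_eq_one
      rw [Finset.sum_eq_zero fun a _ => ((hle a).trans_eq h.symm).antisymm (p.2.1 a)] at h₁
      exact zero_ne_one h₁
    have hw : ∀ i, ∃ v, R v (x i) ∧ (t : ℝ) ≤ p.1 v := by
      intro i
      by_contra! h
      have h₁ : 0 < sweep R x t p.1 (x i) := by
        refine add_pos_of_nonneg_of_pos (le_max_left _ _)
          (Finset.sum_pos' (fun j _ => hterm _ j) ⟨i, Finset.mem_univ i, ?_⟩)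
        rw [if_pos rfl]
        refine mul_pos htpos (Finset.prod_pos fun v _ => ?_)
        split_ifs with hv
        exacts [lt_max_of_lt_right (sub_pos.2 (h v hv.2)), one_pos]
      exact h₁.ne' (hzero _)
    choose w hwR hwt using hw
    have hne : ∀ i, p.1 (w i) ≠ 0 := fun i => (htpos.trans_le (hwt i)).ne'
    refine hp w (fun i j hij => ?_) hne
    exact hx (w i) (p.isFlagWeight.mem _ (hne i)) i j (hwR i) (hij ▸ hwR j)
  · rcases sweep_ne_zero ha with h | ⟨i, rfl, -⟩
    exacts [p.isFlagWeight.mem a (hp_mem a h), hxA i]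
  · rcases sweep_ne_zero ha with h | ⟨i, rfl, h⟩ <;>
      rcases sweep_ne_zero hb with h' | ⟨j, rfl, h'⟩
    · exact p.isFlagWeight.pairwise a b (hp_mem a h) (hp_mem b h') hab hRab
    · exact (h' a hab hRab).not_gt h
    · exact (h b hab.symm (hR _ _ hRab)).not_gt h'
    · exact hab (congrArg x (hx _ (hxA i) i j (hxR i) hRab))

end Sweep

/-- If the flag complex has `n + 2` vertices `x i` such that no vertex fails to be joined to two
of them, then its realization is `n`-connected. -/
theorem isNConnectedSpace_realization_flagComplex {ι : Type} [Fintype ι] {x : ι → α} {n : ℕ}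
    (hn : n + 2 ≤ Fintype.card ι) (hR : ∀ a b, R a b → R b a) (hxA : ∀ i, x i ∈ A)
    (hxR : ∀ i, R (x i) (x i)) (hx : ∀ v ∈ A, ∀ i j, R v (x i) → R v (x j) → i = j) :
    IsNConnectedSpace n (Realization (flagComplex A R)) := by
  classical
  obtain ⟨i₀⟩ : Nonempty ι := Fintype.card_pos_iff.1 (by omega)
  have hc : IsFlagWeight A R (Pi.single (x i₀) 1) := by
    have hs : ∀ a, (Pi.single (x i₀) 1 : α → ℝ) a ≠ 0 → a = x i₀ := by
      intro a
      contrapose!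
      exact fun h => Pi.single_eq_of_ne h _
    refine ⟨fun a => ?_, by simp, fun a ha => hs a ha ▸ hxA i₀, fun a b ha hb hab =>
      (hab ((hs a ha).trans (hs b hb).symm)).elim⟩
    rw [Pi.single_apply]
    split_ifs
    exacts [zero_le_one, le_rfl]
  refine ⟨⟨hc.normalize⟩, fun ℓ hℓ => subsingleton_homotopyGroup hc.normalize fun f hf => ?_⟩
  obtain ⟨g, hg, hfg, hcard⟩ := exists_homotopicWith_small_support hR ℓ f hf
  have hw : ∀ z : I × (I^(Fin ℓ)), IsFlagWeight A R (sweep R x z.1 (g z.2).1) := fun z =>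
    isFlagWeight_sweep hR hxA hxR hx (g z.2)
      (fun w hwi h => by have := hcard ι z.2 w hwi h; omega) z.1
  have hcont : Continuous fun z => (hw z).normalize :=
    IsFlagWeight.continuous_normalize hw fun a => (continuous_sweep a).comp
      ((continuous_subtype_val.comp continuous_fst).prodMk
        (continuous_subtype_val.comp (g.continuous.comp continuous_snd)))
  have hconst : ∀ t, ∀ y ∈ Cube.boundary (Fin ℓ), ∀ z ∈ Cube.boundary (Fin ℓ),
      (hw (t, y)).normalize = (hw (t, z)).normalize := by
    intro t y hy z hz
    refine Subtype.ext (funext fun a => ?_)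
    simp only [IsFlagWeight.normalize_apply, hg y hy z hz]
  let g₁ : C(I^(Fin ℓ), Realization (flagComplex A R)) :=
    ⟨fun y => (hw (1, y)).normalize, hcont.comp (by fun_prop)⟩
  have hgg₁ : ContinuousMap.HomotopicWith g g₁ ConstOnBoundary :=
    ⟨⟨⟨⟨fun z => (hw z).normalize, hcont⟩,
      fun y => (hw (0, y)).normalize_eq _ (sweep_zero (g y).2.1), fun y => rfl⟩, hconst⟩⟩
  have hg₁ : ∀ y a, (g₁ y).1 a ≠ 0 → ∃ i, x i = a := by
    intro y a ha
    rcases sweep_ne_zero ((hw (1, y)).normalize_ne_zero_iff.1 ha) with h | ⟨i, hi, -⟩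
    · have := Finset.single_le_sum (fun b _ => (g y).2.1 b) (Finset.mem_univ a)
      rw [(g y).sum_eq_one] at this
      exact (h.not_ge this).elim
    · exact ⟨i, hi⟩
  refine (hfg.trans hgg₁).trans (homotopicWith_of_segment hR (hconst 1) (fun _ _ _ _ => rfl) ?_)
  intro y a b ha hb hab hRab
  obtain ⟨i, rfl⟩ := hg₁ y a ha
  have hb' : b = x i₀ := by
    by_contra h
    exact hc.normalize_ne_zero_iff.1 hb (Pi.single_eq_of_ne h _)
  subst hb'
  exact hab (congrArg x (hx _ (hxA i) i i₀ (hxR i) hRab))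

end FlagComplex

theorem perfectBinaryTree_adj_iff {h : ℕ} {a b : Σ i : Fin (h + 1), Fin (2 ^ (i : ℕ))} :
    (perfectBinaryTree h).Adj a b ↔
      ((b.1 : ℕ) = (a.1 : ℕ) + 1 ∧ (b.2 : ℕ) / 2 = (a.2 : ℕ)) ∨
      ((a.1 : ℕ) = (b.1 : ℕ) + 1 ∧ (a.2 : ℕ) / 2 = (b.2 : ℕ)) := by
  rw [perfectBinaryTree, SimpleGraph.fromRel_adj]
  refine ⟨fun h => h.2, fun h => ⟨?_, h⟩⟩
  rintro rfl
  omega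

/-- The edge joining the `k`-th vertex at depth `d` to its first child. -/
def firstChildEdge {h d : ℕ} (hd : d < h) (k : Fin (2 ^ d)) :
    Sym2 (Σ i : Fin (h + 1), Fin (2 ^ (i : ℕ))) :=
  s(⟨⟨d, by omega⟩, k⟩, ⟨⟨d + 1, by omega⟩, ⟨2 * k, by have := k.2; rw [pow_succ]; omega⟩⟩)

theorem firstChildEdge_mem_edgeSet {h d : ℕ} (hd : d < h) (k : Fin (2 ^ d)) :
    firstChildEdge hd k ∈ (perfectBinaryTree h).edgeSet := by
  rw [firstChildEdge, SimpleGraph.mem_edgeSet, perfectBinaryTree_adj_iff]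
  left
  simp

theorem coe_of_mem_firstChildEdge {h d : ℕ} {hd : d < h} {k : Fin (2 ^ d)}
    {a : Σ i : Fin (h + 1), Fin (2 ^ (i : ℕ))} (ha : a ∈ firstChildEdge hd k) :
    ((a.1 : ℕ) = d ∧ (a.2 : ℕ) = k) ∨ ((a.1 : ℕ) = d + 1 ∧ (a.2 : ℕ) = 2 * k) := by
  rcases Sym2.mem_iff.1 ha with rfl | rfl
  · exact .inl ⟨rfl, rfl⟩
  · exact .inr ⟨rfl, rfl⟩

/-- An edge of the tree cannot meet two first-child edges whose depths agree modulo three. -/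
theorem firstChildEdge_eq_of_incident {h d d' : ℕ} {hd : d < h} {hd' : d' < h} {k : Fin (2 ^ d)}
    {k' : Fin (2 ^ d')} (hmod : d % 3 = d' % 3) {e : Sym2 (Σ i : Fin (h + 1), Fin (2 ^ (i : ℕ)))}
    (he : e ∈ (perfectBinaryTree h).edgeSet) (h₁ : EdgeIncident e (firstChildEdge hd k))
    (h₂ : EdgeIncident e (firstChildEdge hd' k')) : d = d' ∧ (k : ℕ) = k' := by
  obtain ⟨a, hae, ha⟩ := h₁
  obtain ⟨b, hbe, hb⟩ := h₂
  have ha' := coe_of_mem_firstChildEdge ha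
  have hb' := coe_of_mem_firstChildEdge hb
  by_cases hab : a = b
  · subst hab
    omega
  · rw [(Sym2.mem_and_mem_iff hab).1 ⟨hae, hbe⟩, SimpleGraph.mem_edgeSet,
      perfectBinaryTree_adj_iff] at he
    omega

/-- For `h ≥ 3` and `L = ⌈h/3⌉ − 1`, the matching complex of the
perfect binary tree of height `h` is at least
`((Σ_{i=0}^{L} 2^{h−3i−1}) − 2)`-connected.  (Note `L + 1 = ⌈h/3⌉ = (h+2)/3`.) -/
theorem matchingComplex_perfectBinaryTree_connected (h : ℕ) (hh : 3 ≤ h) :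
    IsNConnectedSpace
      ((∑ i ∈ Finset.range ((h + 2) / 3), 2 ^ (h - 3 * i - 1)) - 2)
      (Realization (matchingComplex (perfectBinaryTree h))) := by
  have hlt : ∀ i : Fin ((h + 2) / 3), h - 3 * (i : ℕ) - 1 < h := fun i => by omega
  have hsum : 2 ≤ ∑ i ∈ Finset.range ((h + 2) / 3), 2 ^ (h - 3 * i - 1) := by
    refine le_trans ?_ (Finset.single_le_sum (f := fun i => 2 ^ (h - 3 * i - 1))
      (fun _ _ => Nat.zero_le _) (Finset.mem_range.2 (by omega : 0 < (h + 2) / 3)))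
    exact Nat.le_self_pow (by omega) 2
  refine isNConnectedSpace_realization_flagComplex
    (ι := Σ i : Fin ((h + 2) / 3), Fin (2 ^ (h - 3 * (i : ℕ) - 1)))
    (x := fun z => firstChildEdge (hlt z.1) z.2) (A := (perfectBinaryTree h).edgeSet)
    (R := EdgeIncident) ?_ ?_ ?_ ?_ ?_
  · rw [Fintype.card_sigma, Nat.sub_add_cancel hsum, Finset.sum_range]
    simp
  · exact fun a b ⟨v, hva, hvb⟩ => ⟨v, hvb, hva⟩
  · exact fun z => firstChildEdge_mem_edgeSet _ _
  · exact fun z => ⟨_, Sym2.mem_mk_left _ _, Sym2.mem_mk_left _ _⟩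
  · rintro e he ⟨i, k⟩ ⟨j, l⟩ h₁ h₂
    have hi := i.2
    have hj := j.2
    have hmod : (h - 3 * (i : ℕ) - 1) % 3 = (h - 3 * (j : ℕ) - 1) % 3 := by omega
    obtain ⟨hd, hk⟩ := firstChildEdge_eq_of_incident hmod he h₁ h₂
    obtain rfl : i = j := Fin.ext (by omega)
    obtain rfl : k = l := Fin.ext hk
    rfl
end
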